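/- Let S ⊂ ℝ be a finite set. Then there exist N ∈ ℕ and δ > 0 such that for all n > N and every complex irreducible character φ of the symmetric group Sₙ, there exists a complex irreducible character ψ of Sₙ such that ψ(1)/φ(1) ∈ [δ, ∞) \ S. -/

import Mathlib

open scoped Classical

/-- The set of irreducible complex characters of a group `G`. -/
noncomputable def IrrChar (G : Type) [Monoid G] : Set (G → ℂ) :=
  {f | ∃ V : FDRep ℂ G, CategoryTheory.Simple V ∧ f = FDRep.character V}



namespace SymDeg

open Finset Matrix

/-- `1/m!`, extended by zero to negative integers. -/
noncomputable def gInv (m : ℤ) : ℝ := if m < 0 then 0 else 1 / (m.toNat.factorial : ℝ)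

lemma gInv_neg {m : ℤ} (h : m < 0) : gInv m = 0 := by simp [gInv, h]

lemma gInv_nat (m : ℕ) : gInv (m : ℤ) = 1 / (m.factorial : ℝ) := by
  have : ¬ ((m : ℤ) < 0) := by omega
  simp [gInv]

lemma gInv_mul (m : ℤ) : (m : ℝ) * gInv m = gInv (m - 1) := by
  rcases lt_or_ge m 0 with h | h
  · rw [gInv_neg h, gInv_neg (by omega)]; simp
  · obtain ⟨a, rfl⟩ := Int.eq_ofNat_of_zero_le h
    cases a with
    | zero => simp [gInv_neg]
    | succ a =>
      have : ((a + 1 : ℕ) : ℤ) - 1 = (a : ℤ) := by push_cast; ring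
      rw [this, gInv_nat, gInv_nat, Nat.factorial_succ]
      have := Nat.factorial_ne_zero a
      push_cast
      field_simp

/-- Sum of determinants with one row replaced. -/
noncomputable def Dsum {k : ℕ} (A B : Matrix (Fin k) (Fin k) ℝ) : ℝ :=
  ∑ r, (A.updateRow r (B r)).det

lemma prod_update {k : ℕ} (a b : Fin k → ℝ) (j : Fin k) :
    ∏ i, (if i = j then b i else a i) = b j * ∏ i ∈ univ.erase j, a i := by
  rw [← Finset.mul_prod_erase univ _ (mem_univ j)]
  congr 1
  · simp
  · apply Finset.prod_congr rfl
    intro i hi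
    simp [(Finset.mem_erase.mp hi).1]

lemma Dsum_eq {k : ℕ} (A B : Matrix (Fin k) (Fin k) ℝ) :
    Dsum A B = ∑ σ : Equiv.Perm (Fin k), ((Equiv.Perm.sign σ : ℤ) : ℝ) *
      ∑ j, (B (σ j) j * ∏ i ∈ univ.erase j, A (σ i) i) := by
  unfold Dsum
  simp_rw [det_apply']
  rw [Finset.sum_comm]
  apply Finset.sum_congr rfl
  intro σ _
  rw [← Finset.mul_sum]
  congr 1
  rw [← Equiv.sum_comp σ]
  apply Finset.sum_congr rfl
  intro j _
  rw [← prod_update (fun i => A (σ i) i) (fun i => B (σ i) i)]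
  apply Finset.prod_congr rfl
  intro i _
  by_cases h : i = j
  · subst h; simp
  · have : σ i ≠ σ j := fun h' => h (σ.injective h')
    simp [h, updateRow_ne this]

lemma Dsum_col {k : ℕ} (A B : Matrix (Fin k) (Fin k) ℝ) :
    Dsum A B = ∑ j, (A.updateCol j (fun i => B i j)).det := by
  rw [Dsum_eq]
  simp_rw [det_apply']
  rw [Finset.sum_comm]
  apply Finset.sum_congr rfl
  intro σ _
  rw [← Finset.mul_sum]
  congr 1
  apply Finset.sum_congr rfl
  intro j _
  rw [← prod_update (fun i => A (σ i) i) (fun i => B (σ i) i)]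
  apply Finset.prod_congr rfl
  intro i _
  by_cases h : i = j
  · subst h; simp
  · simp [h, updateCol_ne h]

lemma Dsum_add {k : ℕ} (A B C : Matrix (Fin k) (Fin k) ℝ) :
    Dsum A (B + C) = Dsum A B + Dsum A C := by
  unfold Dsum
  rw [← Finset.sum_add_distrib]
  apply Finset.sum_congr rfl
  intro r _
  exact det_updateRow_add A r (B r) (C r)

lemma Dsum_row {k : ℕ} (A : Matrix (Fin k) (Fin k) ℝ) (c : Fin k → ℝ) :
    Dsum A (of fun i j => c i * A i j) = (∑ i, c i) * A.det := by
  unfold Dsum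
  rw [Finset.sum_mul]
  apply Finset.sum_congr rfl
  intro r _
  have := det_updateRow_smul A r (c r) (A r)
  rw [updateRow_eq_self] at this
  exact this

lemma Dsum_colScale {k : ℕ} (A : Matrix (Fin k) (Fin k) ℝ) (c : Fin k → ℝ) :
    Dsum A (of fun i j => c j * A i j) = (∑ i, c i) * A.det := by
  rw [Dsum_col, Finset.sum_mul]
  apply Finset.sum_congr rfl
  intro r _
  have := det_updateCol_smul A r (c r) (fun i => A i r)
  rw [show (A.updateCol r fun i => A i r) = A from updateCol_eq_self A r] at this
  exact this

noncomputable def MM {k : ℕ} (l : Fin k → ℤ) : Matrix (Fin k) (Fin k) ℝ :=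
  of fun i (j : Fin k) => gInv (l i - (j : ℕ))

/-- Frobenius-type determinant. -/
noncomputable def FF {k : ℕ} (l : Fin k → ℤ) : ℝ := (MM l).det

/-- unit vector -/
def e {k : ℕ} (r : Fin k) : Fin k → ℤ := fun i => if i = r then 1 else 0

lemma e_self {k : ℕ} (r : Fin k) : e r r = 1 := by simp [e]
lemma e_ne {k : ℕ} {r i : Fin k} (h : i ≠ r) : e r i = 0 := by simp [e, h]
lemma sum_e {k : ℕ} (r : Fin k) : ∑ i, e r i = 1 := by simp [e]

lemma MM_add_smul {k : ℕ} (l : Fin k → ℤ) (r : Fin k) (z : ℤ) :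
    MM (l + z • e r) = (MM l).updateRow r (fun j => gInv (l r + z - (j : ℕ))) := by
  ext i j
  by_cases h : i = r
  · subst h; simp [MM, e]
  · simp [MM, e, h, updateRow_ne h]

lemma FF_sub {k : ℕ} (l : Fin k → ℤ) (r : Fin k) :
    FF (l - e r) = ((MM l).updateRow r (fun j => gInv (l r - 1 - (j : ℕ)))).det := by
  have := MM_add_smul l r (-1)
  unfold FF
  rw [show l - e r = l + (-1 : ℤ) • e r by simp [sub_eq_add_neg], this]
  rfl

lemma FF_add {k : ℕ} (l : Fin k → ℤ) (r : Fin k) :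
    FF (l + e r) = ((MM l).updateRow r (fun j => gInv (l r + 1 - (j : ℕ)))).det := by
  have := MM_add_smul l r (1)
  unfold FF
  rw [show l + e r = l + (1 : ℤ) • e r by simp, this]

/-- sum of the initial beta numbers -/
def S0 (k : ℕ) : ℤ := ∑ j : Fin k, ((j : ℕ) : ℤ)

lemma FF_down {k : ℕ} (l : Fin k → ℤ) :
    ∑ r, FF (l - e r) = ((∑ i, l i - S0 k : ℤ) : ℝ) * FF l := by
  have h : ∑ r, FF (l - e r) = Dsum (MM l) (of fun i (j : Fin k) => gInv (l i - 1 - (j : ℕ))) := by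
    simp only [FF_sub]; rfl
  have h2 : (of fun i (j : Fin k) => gInv (l i - 1 - (j : ℕ))) =
      (of fun i (j : Fin k) => (l i : ℝ) * MM l i j) + (of fun i (j : Fin k) => (-((j : ℕ) : ℝ)) * MM l i j) := by
    ext i j
    have := gInv_mul (l i - (j : ℕ))
    simp only [Matrix.add_apply, of_apply, MM]
    rw [show l i - 1 - (j : ℕ) = l i - (j : ℕ) - 1 by ring, ← this]
    push_cast; ring
  rw [h, h2, Dsum_add]
  rw [Dsum_row (MM l) (fun i => (l i : ℝ)), Dsum_colScale (MM l) (fun j => -((j : ℕ) : ℝ))]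
  simp only [FF, S0]
  push_cast
  rw [Finset.sum_neg_distrib]; ring

/-- the shifted matrix -/
noncomputable def NN {k : ℕ} (l : Fin k → ℤ) : Matrix (Fin k) (Fin k) ℝ :=
  of fun i (j : Fin k) => gInv (l i + 1 - (j : ℕ))

lemma det_shift_zero {k : ℕ} (l : Fin k → ℤ) (j : Fin k) (hj : (j : ℕ) ≠ 0) :
    ((MM l).updateCol j (fun i => NN l i j)).det = 0 := by
  let j' : Fin k := ⟨(j : ℕ) - 1, by omega⟩
  have hne : j ≠ j' := by
    intro h; have := congrArg Fin.val h; simp [j'] at this; omega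
  apply det_zero_of_column_eq hne
  intro i
  rw [updateCol_self, updateCol_ne hne.symm]
  simp only [MM, NN, of_apply, j']
  congr 1
  push_cast [Nat.one_le_iff_ne_zero.mpr hj]
  ring

lemma Dsum_shift_scaled {k : ℕ} (l : Fin k → ℤ) (c : ℕ → ℝ) (hc : c 0 = 0) :
    Dsum (MM l) (of fun i (j : Fin k) => c j * NN l i j) = 0 := by
  rw [Dsum_col]
  apply Finset.sum_eq_zero
  intro j _
  have := det_updateCol_smul (MM l) j (c j) (fun i => NN l i j)
  have h2 : (c j • fun i => NN l i j) = (fun i => c j * NN l i j) := rfl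
  rw [h2] at this
  refine Eq.trans this ?_
  by_cases hj : (j : ℕ) = 0
  · simp [hj, hc]
  · rw [det_shift_zero l j hj, mul_zero]

lemma FF_up {k : ℕ} (l : Fin (k + 1) → ℤ) (h0 : l 0 = 0) :
    ∑ r, FF (l + e r) = FF l := by
  have h : ∑ r, FF (l + e r) = Dsum (MM l) (NN l) := by
    simp only [FF_add]; rfl
  rw [h, Dsum_col, Fin.sum_univ_succ, Finset.sum_eq_zero, add_zero]
  · have h1 : (fun i => NN l i 0) = (fun i => MM l i 0) + (fun i => NN l i 0 - MM l i 0) := by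
      ext i; simp
    rw [h1, det_updateCol_add]
    rw [show ((MM l).updateCol 0 fun i => MM l i 0) = MM l from updateCol_eq_self _ _]
    have hz : ((MM l).updateCol 0 fun i => NN l i 0 - MM l i 0).det = 0 := by
      apply det_eq_zero_of_row_eq_zero (0 : Fin (k+1))
      intro j
      by_cases hj : j = 0
      · subst hj
        simp [MM, NN, h0, gInv]
      · rw [updateCol_ne hj]
        have : (j : ℕ) ≠ 0 := fun h => hj (Fin.ext h)
        simp only [MM, of_apply, h0]
        apply gInv_neg; omega
    rw [hz, add_zero]; rfl
  · intro j _
    apply det_shift_zero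
    simp

lemma FF_up1 {k : ℕ} (l : Fin k → ℤ) :
    ∑ r, ((l r : ℝ) + 1) * FF (l + e r) = k * FF l := by
  have h : ∑ r, ((l r : ℝ) + 1) * FF (l + e r) =
      Dsum (MM l) (of fun i (j : Fin k) => ((l i : ℝ) + 1) * NN l i j) := by
    unfold Dsum
    apply Finset.sum_congr rfl
    intro r _
    rw [FF_add, ← det_updateRow_smul]; rfl
  have h2 : (of fun i (j : Fin k) => ((l i : ℝ) + 1) * NN l i j ) =
      (of fun i (j : Fin k) => ((j : ℕ) : ℝ) * NN l i j) + (of fun i (j : Fin k) => 1 * MM l i j) := by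
    ext i j
    have := gInv_mul (l i + 1 - (j : ℕ))
    simp only [Matrix.add_apply, of_apply, MM, NN]
    rw [show l i + 1 - (j : ℕ) - 1 = l i - (j : ℕ) by ring] at this
    rw [← this]
    push_cast; ring
  rw [h, h2, Dsum_add, Dsum_shift_scaled l (fun n => (n : ℝ)) (by simp),
    Dsum_row (MM l) (fun _ => 1)]
  simp [FF]

lemma FF_up2 {k : ℕ} (l : Fin k → ℤ) :
    ∑ r, ((l r : ℝ) + 1) ^ 2 * FF (l + e r) = ((∑ i, l i + k + S0 k : ℤ) : ℝ) * FF l := by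
  have h : ∑ r, ((l r : ℝ) + 1) ^ 2 * FF (l + e r) =
      Dsum (MM l) (of fun i (j : Fin k) => ((l i : ℝ) + 1) ^ 2 * NN l i j) := by
    unfold Dsum
    apply Finset.sum_congr rfl
    intro r _
    rw [FF_add, ← det_updateRow_smul]; rfl
  have h2 : (of fun i (j : Fin k) => ((l i : ℝ) + 1) ^ 2 * NN l i j ) =
      (of fun i (j : Fin k) => ((j : ℕ) : ℝ) ^ 2 * NN l i j) + ((of fun i (j : Fin k) => ((l i : ℝ) + 1) * MM l i j) +
        (of fun i (j : Fin k) => ((j : ℕ) : ℝ) * MM l i j)) := by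
    ext i j
    have := gInv_mul (l i + 1 - (j : ℕ))
    simp only [Matrix.add_apply, of_apply, MM, NN]
    rw [show l i + 1 - (j : ℕ) - 1 = l i - (j : ℕ) by ring] at this
    rw [← this]
    push_cast; ring
  rw [h, h2, Dsum_add, Dsum_add, Dsum_shift_scaled l (fun n => (n : ℝ) ^ 2) (by simp),
    Dsum_row (MM l) (fun i => (l i : ℝ) + 1), Dsum_colScale (MM l) (fun j => ((j : ℕ) : ℝ))]
  simp only [FF, S0, Finset.sum_add_distrib]
  push_cast
  simp
  ring

lemma FF_eq_zero_of_eq {k : ℕ} (l : Fin k → ℤ) {i j : Fin k} (hij : i ≠ j) (h : l i = l j) :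
    FF l = 0 := by
  unfold FF
  apply det_zero_of_row_eq hij
  ext a
  simp [MM, h]

lemma FF_eq_zero_of_neg {k : ℕ} (l : Fin k → ℤ) {i : Fin k} (h : l i < 0) :
    FF l = 0 := by
  unfold FF
  apply det_eq_zero_of_row_eq_zero i
  intro a
  simp only [MM, of_apply]
  exact gInv_neg (by omega)

lemma FF_init {k : ℕ} : FF (fun i : Fin k => ((i : ℕ) : ℤ)) = 1 := by
  unfold FF
  rw [det_of_isLowerTriangular]
  · apply Finset.prod_eq_one
    intro i _
    simp [MM, gInv]
  · intro i j hij
    apply gInv_neg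
    have : i < j := hij
    have : (i : ℕ) < j := this
    show ((i : ℕ) : ℤ) - (j : ℕ) < 0
    omega

lemma gInv_desc (a j : ℕ) :
    gInv ((a : ℤ) - j) = gInv a * (descPochhammer ℝ j).eval (a : ℝ) := by
  rw [descPochhammer_eval_eq_descFactorial, gInv_nat]
  rcases lt_or_ge a j with h | h
  · rw [gInv_neg (by omega), Nat.descFactorial_of_lt h]; simp
  · rw [show (a : ℤ) - j = ((a - j : ℕ) : ℤ) by push_cast [h]; ring, gInv_nat]
    have := Nat.factorial_mul_descFactorial h
    have h1 := Nat.factorial_ne_zero a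
    have h2 := Nat.factorial_ne_zero (a - j)
    rw [← this]
    have h3 : (a.descFactorial j : ℝ) ≠ 0 := by
      intro h; rw [Nat.cast_eq_zero] at h; rw [h] at this; simp at this; exact h1 this.symm
    push_cast
    field_simp

lemma FF_prod {k : ℕ} (l : Fin k → ℤ) (h : ∀ i, 0 ≤ l i) :
    FF l = (∏ i, gInv (l i)) * ∏ i : Fin k, ∏ j ∈ Ioi i, ((l j : ℝ) - l i) := by
  have hv := det_eval_matrixOfPolynomials_eq_det_vandermonde (fun i => (l i : ℝ))
      (fun i : Fin k => descPochhammer ℝ i)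
      (fun i => descPochhammer_natDegree ℝ i)
      (fun i => monic_descPochhammer ℝ i)
  rw [← det_vandermonde, hv, ← det_mul_column]
  unfold FF
  congr 1
  ext i j
  obtain ⟨a, ha⟩ := Int.eq_ofNat_of_zero_le (h i)
  simp only [MM, of_apply, ha]
  rw [gInv_desc]
  simp

lemma gInv_pos {m : ℤ} (h : 0 ≤ m) : 0 < gInv m := by
  obtain ⟨a, rfl⟩ := Int.eq_ofNat_of_zero_le h
  rw [gInv_nat]; positivity

lemma FF_pos {k : ℕ} (l : Fin k → ℤ) (h : ∀ i, 0 ≤ l i) (hm : StrictMono l) : 0 < FF l := by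
  rw [FF_prod l h]
  apply mul_pos
  · exact Finset.prod_pos fun i _ => gInv_pos (h i)
  · apply Finset.prod_pos; intro i _
    apply Finset.prod_pos; intro j hj
    have := hm (Finset.mem_Ioi.mp hj)
    have : (l i : ℝ) < l j := by exact_mod_cast this
    linarith

lemma FF_inter {k : ℕ} (l : Fin k → ℤ) (h : ∀ i, 0 ≤ l i) (r s : Fin k) (hrs : r < s) :
    FF (l + e r + e s) * FF l * (((l r : ℝ) - l s) ^ 2 - 1) =
      FF (l + e r) * FF (l + e s) * ((l r : ℝ) - l s) ^ 2 := by
  have he : ∀ (t i : Fin k), 0 ≤ e t i := by intro t i; unfold e; split <;> simp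
  rw [FF_prod l h, FF_prod (l + e r) (fun i => add_nonneg (h i) (he r i)),
    FF_prod (l + e s) (fun i => add_nonneg (h i) (he s i)),
    FF_prod (l + e r + e s) (fun i => add_nonneg (add_nonneg (h i) (he r i)) (he s i))]
  have h1 : (∏ i, gInv ((l + e r + e s) i)) * (∏ i, gInv (l i)) =
      (∏ i, gInv ((l + e r) i)) * (∏ i, gInv ((l + e s) i)) := by
    rw [← Finset.prod_mul_distrib, ← Finset.prod_mul_distrib]
    apply Finset.prod_congr rfl
    intro i _
    by_cases hi : i = r
    · have : i ≠ s := by rintro rfl; exact absurd hi hrs.ne'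
      simp [e, hi, hrs.ne]
    · simp [e, hi, mul_comm]
  have h2 : (∏ i : Fin k, ∏ j ∈ Ioi i, ((((l + e r + e s) j : ℤ) : ℝ) - ((l + e r + e s) i : ℤ))) *
      (∏ i : Fin k, ∏ j ∈ Ioi i, ((l j : ℝ) - l i)) * (((l r : ℝ) - l s) ^ 2 - 1) =
      (∏ i : Fin k, ∏ j ∈ Ioi i, ((((l + e r) j : ℤ) : ℝ) - ((l + e r) i : ℤ))) *
      (∏ i : Fin k, ∏ j ∈ Ioi i, ((((l + e s) j : ℤ) : ℝ) - ((l + e s) i : ℤ))) *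
      ((l r : ℝ) - l s) ^ 2 := by
    have key : ∀ c : ℝ, (∏ i : Fin k, ∏ j ∈ Ioi i, if i = r ∧ j = s then c else 1) = c := by
      intro c
      rw [Finset.prod_eq_single r, Finset.prod_eq_single s]
      · simp
      · intro b _ hb; simp [hb]
      · intro hb; exact absurd (Finset.mem_Ioi.mpr hrs) hb
      · intro b _ hb; simp [hb]
      · intro hb; exact absurd (mem_univ _) hb
    conv_lhs => rw [← key (((l r : ℝ) - l s) ^ 2 - 1)]
    conv_rhs => rw [← key (((l r : ℝ) - l s) ^ 2)]
    simp only [← Finset.prod_mul_distrib]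
    apply Finset.prod_congr rfl
    intro i _
    apply Finset.prod_congr rfl
    intro j hj
    have hij : i < j := Finset.mem_Ioi.mp hj
    by_cases hc : i = r ∧ j = s
    · obtain ⟨rfl, rfl⟩ := hc
      simp [e, hij.ne, hij.ne']
      ring
    · rw [if_neg hc, if_neg hc, mul_one, mul_one]
      simp only [Pi.add_apply]
      by_cases h3 : i = r
      · have h4 : j ≠ s := fun h => hc ⟨h3, h⟩
        have h5 : i ≠ s := fun h => hrs.ne (h3.symm.trans h)
        have h6 : j ≠ r := fun h => hij.ne (h3.trans h.symm)
        simp [e, h3, h4, h6, hrs.ne, mul_comm]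
      · by_cases h7 : j = s
        · have : i ≠ s := fun h => hij.ne (h.trans h7.symm)
          simp [e, h7, h3, this, hrs.ne']; ring
        · by_cases h8 : j = r
          · have : i ≠ s := fun h => by rw [h8, h] at hij; exact absurd hij hrs.asymm
            simp [e, h7, h3, this, h8, hrs.ne]
          · by_cases h9 : i = s
            · simp [e, h8, h9, h7, hrs.ne']; ring
            · simp [e, h3, h7, h8, h9]
  linear_combination (((∏ i : Fin k, ∏ j ∈ Ioi i, ((((l + e r + e s) j : ℤ) : ℝ) - ((l + e r + e s) i : ℤ))) *
      (∏ i : Fin k, ∏ j ∈ Ioi i, ((l j : ℝ) - l i)) * (((l r : ℝ) - l s) ^ 2 - 1))) * h1 +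
      (∏ i, gInv ((l + e r) i)) * (∏ i, gInv ((l + e s) i)) * h2

end SymDeg



namespace SymDeg

open Finset

/-- `l` is the vector of beta numbers (with `k` rows) of a partition of `m`. -/
def Sh {k : ℕ} (m : ℕ) (l : Fin k → ℤ) : Prop :=
  StrictMono l ∧ (∀ i, 0 ≤ l i) ∧ ∑ i, l i = m + S0 k

lemma strictMono_gap {c : ℕ} (g : Fin c → ℤ) (hg : StrictMono g) (i j : Fin c) (hij : i ≤ j) :
    ((j : ℕ) : ℤ) - (i : ℕ) ≤ g j - g i := by
  obtain ⟨j, hj⟩ := j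
  obtain ⟨i, hi⟩ := i
  have hij' : i ≤ j := hij
  clear hij
  induction j, hij' using Nat.le_induction with
  | base => simp
  | succ j hij ih =>
    have h1 := ih (by omega)
    have h2 : g ⟨j, by omega⟩ < g ⟨j + 1, hj⟩ := hg (by simp [Fin.lt_def])
    push_cast at *
    omega

lemma FF_nonneg_of_monotone {k : ℕ} (l : Fin k → ℤ) (h : Monotone l) : 0 ≤ FF l := by
  by_cases h0 : ∃ i, l i < 0
  · obtain ⟨i, hi⟩ := h0
    rw [FF_eq_zero_of_neg l hi]
  · push Not at h0
    by_cases hi : Function.Injective l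
    · exact (FF_pos l h0 (h.strictMono_of_injective hi)).le
    · simp only [Function.Injective] at hi
      push Not at hi
      obtain ⟨a, b, hab, hne⟩ := hi
      rw [FF_eq_zero_of_eq l hne hab]

lemma strict_of_FF_ne {k : ℕ} (l : Fin k → ℤ) (h : Monotone l) (hF : FF l ≠ 0) :
    StrictMono l ∧ ∀ i, 0 ≤ l i := by
  constructor
  · apply h.strictMono_of_injective
    intro a b hab
    by_contra hne
    exact hF (FF_eq_zero_of_eq l hne hab)
  · intro i
    by_contra hi
    exact hF (FF_eq_zero_of_neg l (not_le.mp hi))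

lemma mono_add {k : ℕ} (l : Fin k → ℤ) (h : StrictMono l) (r : Fin k) : Monotone (l + e r) := by
  intro i j hij
  rcases hij.eq_or_lt with rfl | hlt
  · exact le_rfl
  · have := h hlt
    simp only [Pi.add_apply, e]
    split <;> split <;> omega

lemma mono_sub {k : ℕ} (l : Fin k → ℤ) (h : StrictMono l) (r : Fin k) : Monotone (l - e r) := by
  intro i j hij
  rcases hij.eq_or_lt with rfl | hlt
  · exact le_rfl
  · have := h hlt
    simp only [Pi.sub_apply, e]
    split <;> split <;> omega

lemma Sh.pos {k m : ℕ} {l : Fin k → ℤ} (h : Sh m l) : 0 < FF l := FF_pos l h.2.1 h.1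

lemma Sh.add {k m : ℕ} {l : Fin k → ℤ} (h : Sh m l) (r : Fin k) (hF : FF (l + e r) ≠ 0) :
    Sh (m + 1) (l + e r) := by
  obtain ⟨h1, h2⟩ := strict_of_FF_ne _ (mono_add l h.1 r) hF
  refine ⟨h1, h2, ?_⟩
  have := h.2.2
  simp only [Pi.add_apply, Finset.sum_add_distrib, sum_e, this]
  push_cast; ring

lemma Sh.sub {k m : ℕ} {l : Fin k → ℤ} (h : Sh (m + 1) l) (r : Fin k) (hF : FF (l - e r) ≠ 0) :
    Sh m (l - e r) := by
  obtain ⟨h1, h2⟩ := strict_of_FF_ne _ (mono_sub l h.1 r) hF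
  refine ⟨h1, h2, ?_⟩
  have := h.2.2
  simp only [Pi.sub_apply, Finset.sum_sub_distrib, sum_e, this]
  push_cast; ring

lemma two_S0 (k : ℕ) : 2 * S0 k = k * (k - 1) := by
  unfold S0
  induction k with
  | zero => simp
  | succ k ih =>
    rw [Fin.sum_univ_castSucc, mul_add]
    simp only [Fin.val_castSucc, Fin.val_last]
    rw [ih]; push_cast; ring

lemma Sh.ge {k m : ℕ} {l : Fin (k + 1) → ℤ} (h : Sh m l) (i : Fin (k + 1)) :
    ((i : ℕ) : ℤ) + l 0 ≤ l i := by
  have := strictMono_gap l h.1 0 i (Fin.zero_le i)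
  simp at this; omega

lemma Sh.zero {k m : ℕ} {l : Fin (k + 1) → ℤ} (h : Sh m l) (hm : m < k + 1) : l 0 = 0 := by
  by_contra hne
  have h0 : 1 ≤ l 0 := by have := h.2.1 0; omega
  have : ∑ i : Fin (k + 1), (((i : ℕ) : ℤ) + 1) ≤ ∑ i, l i :=
    Finset.sum_le_sum fun i _ => by have := h.ge i; omega
  rw [Finset.sum_add_distrib, h.2.2] at this
  unfold S0 at this
  simp at this
  omega

/-- number of removable corners -/
lemma corners {k m : ℕ} {l : Fin k → ℤ} (h : Sh m l) :
    ((univ.filter fun r => FF (l - e r) ≠ 0).card : ℝ) ≤ 2 * Real.sqrt m := by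
  set C := univ.filter fun r => FF (l - e r) ≠ 0 with hC
  let em := C.orderEmbOfFin rfl
  let part : Fin k → ℤ := fun i => l i - (i : ℕ)
  have hmem : ∀ a, FF (l - e (em a)) ≠ 0 := by
    intro a
    have : em a ∈ C := Finset.orderEmbOfFin_mem C rfl a
    simpa [hC] using this
  have hpart_mono : ∀ i j : Fin k, i ≤ j → part i ≤ part j := by
    intro i j hij
    have := strictMono_gap l h.1 i j hij
    simp only [part]; omega
  have hpart_nonneg : ∀ i, 0 ≤ part i := by
    intro i
    have h1 := strictMono_gap l h.1 ⟨0, by have := i.2; omega⟩ i (by simp [Fin.le_def])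
    have := h.2.1 ⟨0, by have := i.2; omega⟩
    simp only [part]; simp only at h1; push_cast at h1; omega
  have hstrict : ∀ (a : Fin C.card) (i : Fin k), i < em a → part i < part (em a) := by
    intro a i hi
    have hs := (strict_of_FF_ne _ (mono_sub l h.1 (em a)) (hmem a)).1
    have h1 := strictMono_gap _ hs i (em a) hi.le
    simp only [Pi.sub_apply, e_self, e_ne hi.ne] at h1
    simp only [part]; omega
  have hpos : ∀ a, 1 ≤ part (em a) := by
    intro a
    have hs := (strict_of_FF_ne _ (mono_sub l h.1 (em a)) (hmem a))
    by_cases h0 : ((em a : Fin k) : ℕ) = 0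
    · have := hs.2 (em a)
      simp only [Pi.sub_apply, e_self] at this
      simp only [part]; omega
    · have h1 := hstrict a ⟨0, by have := (em a).2; omega⟩ (by rw [Fin.lt_def]; simp; omega)
      have := hpart_nonneg ⟨0, by have := (em a).2; omega⟩
      omega
  have hg : StrictMono (fun a => part (em a)) := by
    intro a b hab
    exact hstrict b (em a) (em.strictMono hab)
  have hge : ∀ a : Fin C.card, ((a : ℕ) : ℤ) + 1 ≤ part (em a) := by
    intro a
    have h1 := strictMono_gap _ hg ⟨0, by have := a.2; omega⟩ a (by simp [Fin.le_def])
    have h2 := hpos ⟨0, by have := a.2; omega⟩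
    simp only at h1; push_cast at h1; omega
  have hsum : ∑ i, part i = m := by
    simp only [part, Finset.sum_sub_distrib, h.2.2, S0]; ring
  have hle : ∑ a : Fin C.card, part (em a) ≤ ∑ i, part i := by
    rw [← Finset.sum_image (f := part) (s := univ) (g := em) (fun a _ b _ hab => em.injective hab)]
    exact Finset.sum_le_sum_of_subset_of_nonneg (Finset.subset_univ _)
      (fun i _ _ => hpart_nonneg i)
  have hlow : ∑ a : Fin C.card, (((a : ℕ) : ℤ) + 1) ≤ m := by
    rw [← hsum]
    exact (Finset.sum_le_sum fun a _ => hge a).trans hle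
  rw [Finset.sum_add_distrib] at hlow
  have h2 := two_S0 C.card
  unfold S0 at h2
  simp only [Finset.sum_const, Finset.card_univ, Fintype.card_fin, smul_eq_mul, mul_one,
    nsmul_eq_mul] at hlow
  have h3 : (C.card : ℤ) ^ 2 ≤ 4 * m := by nlinarith
  have h4 : (C.card : ℝ) ^ 2 ≤ 4 * m := by exact_mod_cast h3
  rw [show (2 : ℝ) * Real.sqrt m = Real.sqrt (4 * m) by
    rw [Real.sqrt_mul (by norm_num), show (4 : ℝ) = 2 ^ 2 by norm_num, Real.sqrt_sq (by norm_num)]]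
  exact Real.le_sqrt_of_sq_le h4

lemma down_step {k m : ℕ} {l : Fin k → ℤ} (h : Sh (m + 1) l) :
    ∃ r, Sh m (l - e r) ∧ Real.sqrt (m + 1 : ℕ) / 2 * FF l ≤ FF (l - e r) := by
  set C := univ.filter fun r => FF (l - e r) ≠ 0 with hC
  have hc := corners h
  rw [← hC] at hc
  have hsum : ∑ r ∈ C, FF (l - e r) = ((m + 1 : ℕ) : ℝ) * FF l := by
    rw [hC, Finset.sum_filter_ne_zero, FF_down, h.2.2]
    push_cast; ring
  have hpos := h.pos
  have hm : (0 : ℝ) < ((m + 1 : ℕ) : ℝ) := by positivity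
  have hs : (0 : ℝ) < Real.sqrt (m + 1 : ℕ) := Real.sqrt_pos.mpr hm
  have hss := Real.mul_self_sqrt hm.le
  have hne : C.Nonempty := by
    by_contra hne
    rw [Finset.not_nonempty_iff_eq_empty] at hne
    rw [hne] at hsum
    simp at hsum
    rcases hsum with h | h
    · norm_cast at h
    · exact hpos.ne' h
  obtain ⟨r, hr, hle⟩ := Finset.exists_le_of_sum_le (s := C)
    (f := fun _ => Real.sqrt (m + 1 : ℕ) / 2 * FF l) (g := fun r => FF (l - e r)) hne (by
      rw [hsum, Finset.sum_const, nsmul_eq_mul]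
      have : (C.card : ℝ) * (Real.sqrt (m + 1 : ℕ) / 2) ≤ ((m + 1 : ℕ) : ℝ) := by nlinarith
      nlinarith)
  refine ⟨r, h.sub r ?_, hle⟩
  rw [hC, Finset.mem_filter] at hr
  exact hr.2

/-- transition probability -/
noncomputable def pr {k : ℕ} (l : Fin k → ℤ) (r : Fin k) : ℝ := FF (l + e r) / FF l

lemma pr_nonneg {k m : ℕ} {l : Fin k → ℤ} (h : Sh m l) (r : Fin k) : 0 ≤ pr l r :=
  div_nonneg (FF_nonneg_of_monotone _ (mono_add l h.1 r)) h.pos.le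

lemma pr_sum {k m : ℕ} {l : Fin (k + 1) → ℤ} (h : Sh m l) (hm : m < k + 1) :
    ∑ r, pr l r = 1 := by
  unfold pr
  rw [← Finset.sum_div, FF_up l (h.zero hm), div_self h.pos.ne']

lemma pr_var {k m : ℕ} {l : Fin (k + 1) → ℤ} (h : Sh m l) (hm : m < k + 1) :
    ∑ r, ((l r - k : ℤ) : ℝ) ^ 2 * pr l r = m := by
  have hp := h.pos.ne'
  have h1 := FF_up l (h.zero hm)
  have h2 := FF_up1 l
  have h3 := FF_up2 l
  have h4 : ∑ r, ((l r - k : ℤ) : ℝ) ^ 2 * FF (l + e r) = m * FF l := by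
    have : ∀ r, ((l r - k : ℤ) : ℝ) ^ 2 * FF (l + e r) = ((l r : ℝ) + 1) ^ 2 * FF (l + e r)
        - 2 * (k + 1) * (((l r : ℝ) + 1) * FF (l + e r)) + (k + 1) ^ 2 * FF (l + e r) := by
      intro r; push_cast; ring
    simp only [this]
    rw [Finset.sum_add_distrib, Finset.sum_sub_distrib, ← Finset.mul_sum, ← Finset.mul_sum,
      h1, h2, h3, h.2.2]
    have h5 : (2 : ℝ) * (S0 (k + 1) : ℝ) = (k + 1) * k := by
      have := two_S0 (k + 1)
      have h6 : ((2 * S0 (k + 1) : ℤ) : ℝ) = (((k + 1 : ℕ) : ℤ) * (((k + 1 : ℕ) : ℤ) - 1) : ℤ) := by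
        rw [this]
      push_cast at h6
      rw [h6]; ring
    push_cast
    linear_combination (FF l) * h5
  unfold pr
  have : ∀ r, ((l r - k : ℤ) : ℝ) ^ 2 * (FF (l + e r) / FF l) =
    ((l r - k : ℤ) : ℝ) ^ 2 * FF (l + e r) / FF l := fun r => by ring
  simp only [this]
  rw [← Finset.sum_div, h4]
  field_simp

/-- probability lemma -/
lemma prob_bulk {ι : Type} [Fintype ι] (p : ι → ℝ) (hp : ∀ i, 0 ≤ p i) (hs : ∑ i, p i = 1)
    (c : ι → ℤ) (hc : Function.Injective c) (s : ℝ) (hs1 : 1 ≤ s)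
    (hv : ∑ i, (c i : ℝ) ^ 2 * p i ≤ s ^ 2) :
    ∃ B : Finset ι, 3 / 4 ≤ ∑ i ∈ B, p i ∧ (B.card : ℝ) ≤ 5 * s := by
  refine ⟨univ.filter fun i => |(c i : ℝ)| ≤ 2 * s, ?_, ?_⟩
  · set B := univ.filter fun i => |(c i : ℝ)| ≤ 2 * s with hB
    have h1 : ∑ i ∈ B, p i + ∑ i ∈ Bᶜ, p i = 1 := by rw [Finset.sum_add_sum_compl, hs]
    have h2 : ∑ i ∈ Bᶜ, (4 * s ^ 2) * p i ≤ s ^ 2 := by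
      refine le_trans ?_ hv
      refine le_trans (Finset.sum_le_sum (g := fun i => (c i : ℝ) ^ 2 * p i) ?_)
        (Finset.sum_le_sum_of_subset_of_nonneg (Finset.subset_univ _)
          (fun i _ _ => mul_nonneg (sq_nonneg _) (hp i)))
      intro i hi
      simp only [hB, Finset.mem_compl, Finset.mem_filter, Finset.mem_univ, true_and, not_le] at hi
      apply mul_le_mul_of_nonneg_right _ (hp i)
      rw [← sq_abs (c i : ℝ)]
      nlinarith
    rw [← Finset.mul_sum] at h2
    have h3 : ∑ i ∈ Bᶜ, p i ≤ 1 / 4 := by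
      by_contra hcon
      push Not at hcon
      have : 0 < s ^ 2 := by positivity
      nlinarith
    linarith
  · have hsub : (univ.filter fun i => |(c i : ℝ)| ≤ 2 * s).image c ⊆
        Finset.Icc (-⌊2 * s⌋) ⌊2 * s⌋ := by
      intro z hz
      simp only [Finset.mem_image, Finset.mem_filter, Finset.mem_univ, true_and] at hz
      obtain ⟨i, hi, rfl⟩ := hz
      rw [abs_le] at hi
      rw [Finset.mem_Icc]
      constructor
      · rw [neg_le]; apply Int.le_floor.mpr; push_cast; linarith
      · exact Int.le_floor.mpr hi.2
    have h1 := Finset.card_le_card hsub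
    rw [Finset.card_image_of_injective _ hc, Int.card_Icc] at h1
    have hf : (0 : ℤ) ≤ ⌊2 * s⌋ := Int.floor_nonneg.mpr (by linarith)
    have h2 : (((univ.filter fun i => |(c i : ℝ)| ≤ 2 * s).card : ℕ) : ℤ) ≤ 2 * ⌊2 * s⌋ + 1 := by
      omega
    have h3 : (((univ.filter fun i => |(c i : ℝ)| ≤ 2 * s).card : ℕ) : ℝ) ≤ 2 * (⌊2 * s⌋ : ℝ) + 1 := by
      exact_mod_cast h2
    have := Int.floor_le (2 * s)
    linarith

lemma prob_exists {ι : Type} [Fintype ι] (p : ι → ℝ) (hp : ∀ i, 0 ≤ p i) (hs : ∑ i, p i = 1)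
    (c : ι → ℤ) (hc : Function.Injective c) (s : ℝ) (hs1 : 1 ≤ s)
    (hv : ∑ i, (c i : ℝ) ^ 2 * p i ≤ s ^ 2) :
    ∃ i, 3 / (20 * s) ≤ p i := by
  obtain ⟨B, h1, h2⟩ := prob_bulk p hp hs c hc s hs1 hv
  have hne : B.Nonempty := by
    by_contra hne
    rw [Finset.not_nonempty_iff_eq_empty] at hne
    rw [hne] at h1; simp at h1; linarith
  obtain ⟨r, _, hle⟩ := Finset.exists_le_of_sum_le (s := B)
    (f := fun _ => 3 / (20 * s)) (g := p) hne (by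
      refine le_trans ?_ h1
      rw [Finset.sum_const, nsmul_eq_mul, mul_div_assoc', div_le_div_iff₀ (by positivity) (by positivity)]
      linarith)
  exact ⟨r, hle⟩

lemma prob_many {ι : Type} [Fintype ι] (p : ι → ℝ) (hp : ∀ i, 0 ≤ p i) (hs : ∑ i, p i = 1)
    (c : ι → ℤ) (hc : Function.Injective c) (s : ℝ) (hs1 : 1 ≤ s)
    (hv : ∑ i, (c i : ℝ) ^ 2 * p i ≤ s ^ 2) (K : ℝ) (hpK : ∀ i, p i ≤ K / s) :
    ∃ R : Finset ι, (∀ i ∈ R, 1 / (20 * s) ≤ p i) ∧ s ≤ 2 * K * R.card := by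
  obtain ⟨B, h1, h2⟩ := prob_bulk p hp hs c hc s hs1 hv
  refine ⟨B.filter fun i => 1 / (20 * s) ≤ p i, fun i hi => (Finset.mem_filter.mp hi).2, ?_⟩
  have h3 := Finset.sum_filter_add_sum_filter_not B (fun i => 1 / (20 * s) ≤ p i) p
  have h4 : ∑ i ∈ B.filter (fun i => ¬ 1 / (20 * s) ≤ p i), p i ≤ 1 / 4 := by
    refine le_trans (Finset.sum_le_sum (g := fun _ => 1 / (20 * s)) ?_) ?_
    · intro i hi
      exact (not_le.mp (Finset.mem_filter.mp hi).2).le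
    · rw [Finset.sum_const, nsmul_eq_mul, mul_div_assoc', div_le_div_iff₀ (by positivity) (by positivity)]
      have : ((B.filter (fun i => ¬ 1 / (20 * s) ≤ p i)).card : ℝ) ≤ B.card := by
        exact_mod_cast Finset.card_le_card (Finset.filter_subset _ _)
      linarith
  have h5 : ∑ i ∈ B.filter (fun i => 1 / (20 * s) ≤ p i), p i ≤
      (B.filter fun i => 1 / (20 * s) ≤ p i).card * (K / s) := by
    rw [← nsmul_eq_mul]
    exact Finset.sum_le_card_nsmul _ _ _ (fun i _ => hpK i)
  have h6 : 1 / 2 ≤ ((B.filter fun i => 1 / (20 * s) ≤ p i).card : ℝ) * (K / s) := by linarith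
  rw [mul_div_assoc', div_le_div_iff₀ (by norm_num) (by positivity)] at h6
  linarith

end SymDeg



namespace SymDeg

open Finset

/-- interaction factor -/
noncomputable def II (d : ℝ) : ℝ := d ^ 2 / (d ^ 2 - 1)

lemma II_neg (d : ℝ) : II (-d) = II d := by simp [II]

lemma II_ge_one {d : ℝ} (h : 2 ≤ d) : 1 ≤ II d := by
  unfold II
  rw [le_div_iff₀ (by nlinarith)]
  linarith

lemma II_le {d D : ℝ} (hD : 2 ≤ D) (h : D ≤ d) : II d * (1 - 1 / D ^ 2) ≤ 1 := by
  have h1 : (1 - 1 / D ^ 2) ≤ (1 - 1 / d ^ 2) := by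
    have : 1 / d ^ 2 ≤ 1 / D ^ 2 := by
      apply one_div_le_one_div_of_le (by positivity)
      nlinarith
    linarith
  have h0 := II_ge_one (hD.trans h)
  have h2 : II d * (1 - 1 / d ^ 2) = 1 := by
    unfold II
    have : d ^ 2 - 1 ≠ 0 := by nlinarith
    have : d ≠ 0 := by linarith
    field_simp
  nlinarith

lemma II_convex {u a b : ℝ} (hu : 2 ≤ u) (ha : 0 < a) (hb : 0 < b) :
    II (u + a) * II (u + b) < II u * II (u + a + b) := by
  unfold II
  have h1 : 0 < u ^ 2 - 1 := by nlinarith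
  have h2 : 0 < (u + a) ^ 2 - 1 := by nlinarith
  have h3 : 0 < (u + b) ^ 2 - 1 := by nlinarith
  have h4 : 0 < (u + a + b) ^ 2 - 1 := by nlinarith
  rw [div_mul_div_comm, div_mul_div_comm, div_lt_div_iff₀ (by positivity) (by positivity)]
  set P := u * (u + a + b) with hP
  set Q := (u + a) * (u + b) with hQ
  set s := u + (u + a + b) with hs
  have e1 : (u ^ 2 - 1) * ((u + a + b) ^ 2 - 1) = (P + 1) ^ 2 - s ^ 2 := by rw [hP, hs]; ring
  have e2 : ((u + a) ^ 2 - 1) * ((u + b) ^ 2 - 1) = (Q + 1) ^ 2 - s ^ 2 := by rw [hQ, hs]; ring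
  have e3 : (u + a) ^ 2 * (u + b) ^ 2 = Q ^ 2 := by rw [hQ]; ring
  have e4 : u ^ 2 * (u + a + b) ^ 2 = P ^ 2 := by rw [hP]; ring
  rw [e1, e2, e3, e4]
  have hPQ : P < Q := by rw [hP, hQ]; nlinarith [mul_pos ha hb]
  have hPpos : 4 ≤ P := by rw [hP]; nlinarith
  have hsQ : 4 * Q ≤ s ^ 2 := by rw [hQ, hs]; nlinarith [sq_nonneg (a - b)]
  have key : P ^ 2 * ((Q + 1) ^ 2 - s ^ 2) - Q ^ 2 * ((P + 1) ^ 2 - s ^ 2) =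
    (Q - P) * ((s ^ 2 - 1) * (P + Q) - 2 * P * Q) := by ring
  have h5 : 0 < (s ^ 2 - 1) * (P + Q) - 2 * P * Q := by nlinarith
  have := mul_pos (sub_pos.mpr hPQ) h5
  linarith

lemma FF_two {k m : ℕ} {l : Fin k → ℤ} (h : Sh m l) {r s : Fin k} (hrs : r < s)
    (hd : 2 ≤ l s - l r) :
    FF (l + e r + e s) = pr l r * pr l s * FF l * II ((l s : ℝ) - l r) := by
  have h1 := FF_inter l h.2.1 r s hrs
  have hp := h.pos.ne'
  have hd' : (2 : ℝ) ≤ (l s : ℝ) - l r := by exact_mod_cast hd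
  unfold pr II
  have h2 : ((l s : ℝ) - l r) ^ 2 - 1 ≠ 0 := by nlinarith
  field_simp
  linear_combination h1

lemma sh_two {k m : ℕ} {l : Fin k → ℤ} (h : Sh m l) {r s : Fin k} (hrs : r < s)
    (hd : 2 ≤ l s - l r) (hr : 0 < pr l r) (hs : 0 < pr l s) : Sh (m + 2) (l + e r + e s) := by
  have h1 : Sh (m + 1) (l + e r) := by
    apply h.add
    intro h0; unfold pr at hr; rw [h0] at hr; simp at hr
  apply h1.add
  rw [FF_two h hrs hd]
  have hd' : (2 : ℝ) ≤ (l s : ℝ) - l r := by exact_mod_cast hd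
  have := II_ge_one hd'
  have := h.pos
  positivity

lemma exists_gap (T : Set ℝ) (hT : T.Finite) :
    ∃ D : ℕ, 2 ≤ D ∧ ∀ t ∈ T, t < 1 → t < (1 - 1 / (D : ℝ) ^ 2) ^ 2 := by
  have h : ∀ t ∈ T, ∀ᶠ D : ℕ in Filter.atTop, t < 1 → t < (1 - 1 / (D : ℝ) ^ 2) ^ 2 := by
    intro t _
    by_cases ht : t < 1
    · have h1 : Filter.Tendsto (fun D : ℕ => (1 - 1 / (D : ℝ) ^ 2) ^ 2) Filter.atTop
          (nhds ((1 - 0) ^ 2)) := by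
        apply Filter.Tendsto.pow
        apply Filter.Tendsto.sub tendsto_const_nhds
        have := (tendsto_one_div_atTop_nhds_zero_nat (𝕜 := ℝ)).pow 2
        simpa using this
      have h2 : t < (1 - 0 : ℝ) ^ 2 := by simpa using ht
      filter_upwards [h1.eventually_const_lt h2] with D hD _ using hD
    · exact Filter.Eventually.of_forall fun D h => absurd h ht
  have h2 := (Filter.eventually_all_finite hT).mpr h
  obtain ⟨D, hD1, hD2⟩ := (h2.and (Filter.eventually_ge_atTop 2)).exists
  exact ⟨D, hD2, hD1⟩

lemma final_lt {A a b c f : ℝ} (hAeq : A * (a * b) = c * f) (ha : 1 ≤ a) (hb : 1 ≤ b)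
    (hcv : c * f < a * b) : A < 1 := by
  by_contra hge
  push Not at hge
  have : 0 < a * b := by positivity
  nlinarith

lemma final_arith {A a b c f D : ℝ} (hAeq : A * (a * b) = c * f) (ha : 1 ≤ a) (hb : 1 ≤ b)
    (hc : 1 ≤ c) (hf : 1 ≤ f) (j03 : a * (1 - 1 / D ^ 2) ≤ 1) (j12 : b * (1 - 1 / D ^ 2) ≤ 1)
    (hD : 2 ≤ D) (hlt : A < (1 - 1 / D ^ 2) ^ 2) : False := by
  have hq0 : 0 ≤ 1 - 1 / D ^ 2 := by
    have : 1 / D ^ 2 ≤ 1 := by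
      rw [div_le_one (by positivity)]; nlinarith
    linarith
  generalize (1 - 1 / D ^ 2) = q at *
  have hcf : 1 ≤ c * f := by nlinarith
  have h7 : (a * q) * (b * q) ≤ 1 := by
    have h1 : 0 ≤ a * q := by positivity
    have h2 : 0 ≤ b * q := by positivity
    nlinarith
  have h8 : 0 < a * b := by positivity
  nlinarith

set_option maxHeartbeats 1000000 in
theorem analytic (S : Set ℝ) (hS : S.Finite) :
    ∃ (N : ℕ) (δ : ℝ), 0 < δ ∧ ∀ n : ℕ, N < n → ∀ l : Fin (n + 1) → ℤ, Sh n l →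
      ∃ l' : Fin (n + 1) → ℤ, Sh n l' ∧ FF l' / FF l ∈ Set.Ici δ \ S := by
  -- constants
  let T : Set ℝ := Set.image (fun q : (ℝ × ℝ) × (ℝ × ℝ) => q.1.1 * q.1.2 / (q.2.1 * q.2.2))
    ((S ×ˢ S) ×ˢ (S ×ˢ S))
  have hT : T.Finite := ((hS.prod hS).prod (hS.prod hS)).image _
  obtain ⟨D, hD2, hDT⟩ := exists_gap T hT
  obtain ⟨M0, hM0⟩ := hS.bddAbove
  let M : ℝ := max M0 1
  have hM1 : 1 ≤ M := le_max_right _ _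
  have hMS : ∀ t ∈ S, t ≤ M := fun t ht => (hM0 ht).trans (le_max_left _ _)
  let K : ℝ := 160 / 3 * M
  obtain ⟨N, hN⟩ := exists_nat_gt ((2 * K * (4 * D + 4)) ^ 2 + 4)
  refine ⟨N, 1 / 3200, by norm_num, ?_⟩
  intro n hn l hl
  by_contra hcon
  push Not at hcon
  have hcon' : ∀ l' : Fin (n + 1) → ℤ, Sh n l' → 1 / 3200 ≤ FF l' / FF l → FF l' / FF l ∈ S := by
    intro l' hl' hge
    by_contra hns
    exact hcon l' hl' ⟨hge, hns⟩
  set d := FF l with hd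
  have hdpos : 0 < d := hl.pos
  have hbound : ∀ l' : Fin (n + 1) → ℤ, Sh n l' → FF l' ≤ M * d := by
    intro l' hl'
    by_cases h : 1 / 3200 ≤ FF l' / d
    · have := hMS _ (hcon' l' hl' h)
      rwa [div_le_iff₀ hdpos] at this
    · push Not at h
      rw [div_lt_iff₀ hdpos] at h
      nlinarith
  have hnN : ((2 * K * (4 * D + 4)) ^ 2 + 4) < (n : ℝ) := hN.trans (by exact_mod_cast hn)
  have hn4 : (4 : ℝ) < n := by nlinarith [sq_nonneg (2 * K * (4 * (D : ℝ) + 4))]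
  have hn4' : 4 < n := by exact_mod_cast hn4
  set s := Real.sqrt n with hs
  have hss : s * s = n := Real.mul_self_sqrt (by linarith)
  have hs0 : 0 ≤ s := Real.sqrt_nonneg _
  have hs1 : 2 ≤ s := by nlinarith
  have hsbig : 2 * K * (4 * D + 4) < s := by
    apply Real.lt_sqrt_of_sq_lt
    linarith
  obtain ⟨m, rfl⟩ : ∃ m, n = m + 2 := ⟨n - 2, by omega⟩
  -- go down
  obtain ⟨r1, hmu, hmu2⟩ := down_step hl
  obtain ⟨r2, hnu, hnu2⟩ := down_step hmu
  set ν := l - e r1 - e r2 with hν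
  have hνpos := hnu.pos
  have hνd : (m + 2 : ℕ) / 8 * d ≤ FF ν := by
    have h1 : s / 2 ≤ Real.sqrt (m + 1 : ℕ) := by
      apply Real.le_sqrt_of_sq_le
      push_cast at hss hn4 ⊢
      nlinarith
    have h2 : s / 2 * d ≤ FF (l - e r1) := hmu2
    have h3 : s / 4 * FF (l - e r1) ≤ FF ν := by
      refine le_trans ?_ hnu2
      apply mul_le_mul_of_nonneg_right _ hmu.pos.le
      linarith
    calc (((m + 2 : ℕ) : ℝ) / 8 * d) = s / 4 * (s / 2 * d) := by rw [← hss]; ring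
      _ ≤ s / 4 * FF (l - e r1) := by apply mul_le_mul_of_nonneg_left h2; positivity
      _ ≤ _ := h3
  -- upper bound in size m+1
  have hup : ∀ l' : Fin (m + 2 + 1) → ℤ, Sh (m + 1) l' → FF l' ≤ 20 / 3 * s * M * d := by
    intro l' hl'
    have hv := pr_var hl' (by omega)
    obtain ⟨r, hr⟩ := prob_exists (pr l') (pr_nonneg hl') (pr_sum hl' (by omega))
      (fun r => l' r - (m + 2 : ℕ)) (fun a b hab => hl'.1.injective (by simpa using hab)) s
      (by linarith) (by
        rw [hv, pow_two, hss]; push_cast; linarith)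
    have hpr : 0 < pr l' r := lt_of_lt_of_le (by positivity) hr
    have hne : FF (l' + e r) ≠ 0 := by
      intro h0; unfold pr at hpr; rw [h0] at hpr; simp at hpr
    have h2 := hbound _ (hl'.add r hne)
    have hp := hl'.pos
    unfold pr at hr
    rw [div_le_div_iff₀ (by positivity) hp] at hr
    nlinarith
  have hpK : ∀ r, pr ν r ≤ K / s := by
    intro r
    by_cases h0 : FF (ν + e r) = 0
    · unfold pr; rw [h0, zero_div]; positivity
    · have h1 := hup _ (hnu.add r h0)
      unfold pr
      rw [div_le_div_iff₀ hνpos (by linarith)]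
      calc FF (ν + e r) * s ≤ 20 / 3 * s * M * d * s := mul_le_mul_of_nonneg_right h1 hs0
        _ = K * (((m + 2 : ℕ) : ℝ) / 8 * d) := by rw [← hss]; simp only [K]; ring
        _ ≤ K * FF ν := by apply mul_le_mul_of_nonneg_left hνd; positivity
  obtain ⟨R, hR1, hR2⟩ := prob_many (pr ν) (pr_nonneg hnu) (pr_sum hnu (by omega))
    (fun r => ν r - (m + 2 : ℕ)) (fun a b hab => hnu.1.injective (by simpa using hab)) s
    (by linarith) (by
      rw [pr_var hnu (by omega), pow_two, hss]; push_cast; linarith) K hpK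
  have hKpos : 0 < K := by positivity
  have hcard : 4 * D + 4 ≤ R.card := by
    have : 2 * K * (4 * D + 4) < 2 * K * R.card := hsbig.trans_le hR2
    have h2 : (4 * D + 4 : ℝ) < R.card := lt_of_mul_lt_mul_left this (by positivity)
    have : 4 * D + 4 < R.card := by exact_mod_cast h2
    omega
  let em := R.orderEmbOfFin rfl
  have hem : ∀ a, em a ∈ R := fun a => Finset.orderEmbOfFin_mem R rfl a
  have hsm : StrictMono (fun a => ν (em a)) := hnu.1.comp em.strictMono
  let x : Fin 4 → Fin (m + 2 + 1) := fun i => em ⟨i * D, by have := i.2; nlinarith⟩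
  have hxR : ∀ i, 1 / (20 * s) ≤ pr ν (x i) := fun i => hR1 _ (hem _)
  have hxpos : ∀ i, 0 < pr ν (x i) := fun i => lt_of_lt_of_le (by positivity) (hxR i)
  have hxlt : ∀ i j : Fin 4, i < j → x i < x j := by
    intro i j hij
    apply em.strictMono
    rw [Fin.lt_def]
    exact Nat.mul_lt_mul_of_pos_right hij (by omega)
  have hxgap : ∀ i j : Fin 4, i < j → (D : ℤ) ≤ ν (x j) - ν (x i) := by
    intro i j hij
    have h1 := strictMono_gap _ hsm ⟨i * D, by have := i.2; nlinarith⟩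
      ⟨j * D, by have := j.2; nlinarith⟩ (by rw [Fin.le_def]; exact Nat.mul_le_mul_right _ hij.le)
    refine le_trans ?_ h1
    have : (i : ℕ) + 1 ≤ j := hij
    push_cast
    have : ((i : ℕ) : ℤ) + 1 ≤ (j : ℕ) := by exact_mod_cast this
    nlinarith
  have hD2' : (2 : ℤ) ≤ D := by exact_mod_cast hD2
  have hxgapR : ∀ i j : Fin 4, i < j → (D : ℝ) ≤ (ν (x j) : ℝ) - ν (x i) := by
    intro i j hij
    exact_mod_cast hxgap i j hij
  have hD2R : (2 : ℝ) ≤ D := by exact_mod_cast hD2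
  let g : Fin 4 → Fin 4 → ℝ := fun i j => FF (ν + e (x i) + e (x j)) / d
  have hgS : ∀ i j : Fin 4, i < j → g i j ∈ S ∧ 0 < g i j := by
    intro i j hij
    have hg2 := hD2'.trans (hxgap i j hij)
    have hsh := sh_two hnu (hxlt i j hij) hg2 (hxpos i) (hxpos j)
    refine ⟨hcon' _ hsh ?_, div_pos hsh.pos hdpos⟩
    rw [le_div_iff₀ hdpos, FF_two hnu (hxlt i j hij) hg2]
    have h1 := II_ge_one (hD2R.trans (hxgapR i j hij))
    have h2 : 1 / (20 * s) * (1 / (20 * s)) ≤ pr ν (x i) * pr ν (x j) :=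
      mul_le_mul (hxR i) (hxR j) (by positivity) (hxpos i).le
    have h3 : 1 / (20 * s) * (1 / (20 * s)) * (((m + 2 : ℕ) : ℝ) / 8 * d) ≤
        pr ν (x i) * pr ν (x j) * FF ν :=
      mul_le_mul h2 hνd (by positivity) (mul_pos (hxpos i) (hxpos j)).le
    have h4 : 1 / (20 * s) * (1 / (20 * s)) * (((m + 2 : ℕ) : ℝ) / 8 * d) = 1 / 3200 * d := by
      rw [← hss]; field_simp; norm_num
    rw [h4] at h3
    have h5 : 0 < pr ν (x i) * pr ν (x j) * FF ν := mul_pos (mul_pos (hxpos i) (hxpos j)) hνpos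
    nlinarith
  have hgeq : ∀ i j : Fin 4, i < j →
      g i j = pr ν (x i) * pr ν (x j) * FF ν * II ((ν (x j) : ℝ) - ν (x i)) / d := by
    intro i j hij
    simp only [g]
    rw [FF_two hnu (hxlt i j hij) (hD2'.trans (hxgap i j hij))]
  have h02 : (0 : Fin 4) < 2 := by decide
  have h13 : (1 : Fin 4) < 3 := by decide
  have h03 : (0 : Fin 4) < 3 := by decide
  have h12 : (1 : Fin 4) < 2 := by decide
  have h01 : (0 : Fin 4) < 1 := by decide
  have h23 : (2 : Fin 4) < 3 := by decide
  set A := g 0 2 * g 1 3 / (g 0 3 * g 1 2) with hA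
  have hAT : A ∈ T := ⟨((g 0 2, g 1 3), (g 0 3, g 1 2)),
    ⟨⟨(hgS 0 2 h02).1, (hgS 1 3 h13).1⟩, ⟨(hgS 0 3 h03).1, (hgS 1 2 h12).1⟩⟩, rfl⟩
  have hAeq : A * (II ((ν (x 3) : ℝ) - ν (x 0)) * II ((ν (x 2) : ℝ) - ν (x 1))) =
      II ((ν (x 2) : ℝ) - ν (x 0)) * II ((ν (x 3) : ℝ) - ν (x 1)) := by
    rw [hA, hgeq 0 2 h02, hgeq 1 3 h13, hgeq 0 3 h03, hgeq 1 2 h12]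
    have := (hxpos 0).ne'
    have := (hxpos 1).ne'
    have := (hxpos 2).ne'
    have := (hxpos 3).ne'
    have := (lt_of_lt_of_le one_pos (II_ge_one (hD2R.trans (hxgapR 0 3 h03)))).ne'
    have := (lt_of_lt_of_le one_pos (II_ge_one (hD2R.trans (hxgapR 1 2 h12)))).ne'
    have := hνpos.ne'
    field_simp
  have i03 := II_ge_one (hD2R.trans (hxgapR 0 3 h03))
  have i12 := II_ge_one (hD2R.trans (hxgapR 1 2 h12))
  have i02 := II_ge_one (hD2R.trans (hxgapR 0 2 h02))
  have i13 := II_ge_one (hD2R.trans (hxgapR 1 3 h13))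
  have j03 := II_le hD2R (hxgapR 0 3 h03)
  have j12 := II_le hD2R (hxgapR 1 2 h12)
  have hcv := II_convex (u := (ν (x 2) : ℝ) - ν (x 1)) (a := (ν (x 1) : ℝ) - ν (x 0))
    (b := (ν (x 3) : ℝ) - ν (x 2)) (hD2R.trans (hxgapR 1 2 h12))
    (by linarith [hxgapR 0 1 h01]) (by linarith [hxgapR 2 3 h23])
  rw [show (ν (x 2) : ℝ) - ν (x 1) + ((ν (x 1) : ℝ) - ν (x 0)) = (ν (x 2) : ℝ) - ν (x 0) by ring,
    show (ν (x 2) : ℝ) - ν (x 1) + ((ν (x 3) : ℝ) - ν (x 2)) = (ν (x 3) : ℝ) - ν (x 1) by ring,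
    show (ν (x 2) : ℝ) - ν (x 0) + ((ν (x 3) : ℝ) - ν (x 2)) = (ν (x 3) : ℝ) - ν (x 0) by ring] at hcv
  have hA1 : A < 1 := final_lt hAeq i03 i12 (hcv.trans_eq (mul_comm _ _))
  have hlt := hDT A hAT hA1
  exact final_arith hAeq i03 i12 i02 i13 j03 j12 hD2R hlt

end SymDeg

namespace SymDeg
open Finset

section reps
variable {G : Type} [Group G] [Fintype G]

/-- bilinear pairing of functions on a finite group -/
noncomputable def ip (f h : G → ℂ) : ℂ := (Nat.card G : ℂ)⁻¹ * ∑ g : G, f g * h g⁻¹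

lemma irr_mem {V : Type} [AddCommGroup V] [Module ℂ V] [FiniteDimensional ℂ V]
    (ρ : Representation ℂ G V) (h : ρ.IsIrreducible) : ρ.character ∈ IrrChar G := by
  have := invertibleOfNonzero (NeZero.ne (Nat.card G : ℂ))
  refine ⟨FDRep.of ρ, ?_, rfl⟩
  rw [FDRep.simple_iff_char_is_norm_one]
  have h1 := ρ.char_orthonormal ρ
  rw [if_pos ⟨Representation.Equiv.refl ρ⟩, inv_mul_eq_one₀ (NeZero.ne _)] at h1
  exact h1.symm

lemma char_split {V : Type} [AddCommGroup V] [Module ℂ V] [FiniteDimensional ℂ V]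
    (ρ : Representation ℂ G V) (W W' : Subrepresentation ρ) (h : IsCompl W W') :
    ρ.character = W.toRepresentation.character + W'.toRepresentation.character := by
  have hc : IsCompl W.toSubmodule W'.toSubmodule := by
    constructor
    · rw [disjoint_iff]
      have := congrArg Subrepresentation.toSubmodule h.1.eq_bot
      exact this
    · rw [codisjoint_iff]
      have := congrArg Subrepresentation.toSubmodule h.2.eq_top
      exact this
  ext g
  let E := Submodule.prodEquivOfIsCompl _ _ hc
  have : ρ g = E.conj ((W.toRepresentation g).prodMap (W'.toRepresentation g)) := by
    ext v
    obtain ⟨⟨a, b⟩, rfl⟩ := E.surjective v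
    simp only [LinearEquiv.conj_apply_apply, LinearEquiv.symm_apply_apply]
    simp [E, Submodule.coe_prodEquivOfIsCompl']
    rfl
  rw [Pi.add_apply]
  simp only [Representation.character]
  rw [this, LinearMap.trace_conj', LinearMap.trace_prodMap']

lemma char_mem_span : ∀ (d : ℕ) (V : Type) [AddCommGroup V] [Module ℂ V] [FiniteDimensional ℂ V]
    (ρ : Representation ℂ G V), Module.finrank ℂ V = d →
    ρ.character ∈ Submodule.span ℤ (IrrChar G) := by
  intro d
  induction d using Nat.strong_induction_on with
  | _ d ih =>
  intro V _ _ _ ρ hd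
  by_cases h0 : d = 0
  · subst h0
    have : Subsingleton V := Module.finrank_zero_iff.mp hd
    have : ρ.character = 0 := by
      ext g
      have : ρ g = 0 := Subsingleton.elim _ _
      simp [Representation.character, this]
    rw [this]; exact zero_mem _
  have hnt : Nontrivial V := Module.nontrivial_of_finrank_pos (R := ℂ) (by omega)
  by_cases hirr : ρ.IsIrreducible
  · exact Submodule.subset_span (irr_mem ρ hirr)
  have hnt2 : Nontrivial (Subrepresentation ρ) := by
    refine ⟨⊥, ⊤, fun h => ?_⟩
    have : (⊥ : Submodule ℂ V) = ⊤ := congrArg Subrepresentation.toSubmodule h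
    exact bot_ne_top this
  have : ∃ W : Subrepresentation ρ, W ≠ ⊥ ∧ W ≠ ⊤ := by
    by_contra hcon
    push Not at hcon
    exact hirr ⟨fun W => by
      by_cases hW : W = ⊥
      · exact Or.inl hW
      · exact Or.inr (hcon W hW)⟩
  obtain ⟨W, hW1, hW2⟩ := this
  obtain ⟨W', hW'⟩ := exists_isCompl W
  have key : ∀ U : Subrepresentation ρ, U ≠ ⊤ → U.toRepresentation.character ∈
      Submodule.span ℤ (IrrChar G) := by
    intro U hU
    refine ih _ ?_ _ _ rfl
    rw [← hd]
    apply Submodule.finrank_lt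
    intro h
    exact hU (Subrepresentation.toSubmodule_injective h)
  rw [char_split ρ W W' hW']
  refine add_mem (key _ hW2) (key _ ?_)
  rintro rfl
  exact hW1 (by simpa using hW'.1.eq_bot)

lemma ip_irr (f h : G → ℂ) (hf : f ∈ IrrChar G) (hh : h ∈ IrrChar G) :
    ip f h = if f = h then 1 else 0 := by
  have := invertibleOfNonzero (NeZero.ne (Nat.card G : ℂ))
  obtain ⟨V, hV, rfl⟩ := hf
  obtain ⟨W, hW, rfl⟩ := hh
  by_cases h : Nonempty (V ≅ W)
  · have h1 := FDRep.char_orthonormal V W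
    rw [if_pos h] at h1
    rw [if_pos (FDRep.char_iso h.some)]
    exact h1
  · have h1 := FDRep.char_orthonormal V W
    rw [if_neg h] at h1
    rw [if_neg]
    · exact h1
    · intro he
      have h2 := FDRep.char_orthonormal V V
      rw [if_pos ⟨CategoryTheory.Iso.refl V⟩] at h2
      rw [← he, h2] at h1
      exact one_ne_zero h1

lemma ip_add_left (f f' h : G → ℂ) : ip (f + f') h = ip f h + ip f' h := by
  simp [ip, add_mul, Finset.sum_add_distrib, mul_add]

lemma ip_sum_left {ι : Type*} (s : Finset ι) (c : ι → ℂ) (f : ι → G → ℂ) (h : G → ℂ) :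
    ip (∑ i ∈ s, c i • f i) h = ∑ i ∈ s, c i * ip (f i) h := by
  simp only [ip, Finset.sum_apply, Finset.sum_mul, Finset.mul_sum, Pi.smul_apply, smul_eq_mul]
  rw [Finset.sum_comm]
  refine Finset.sum_congr rfl fun i _ => Finset.sum_congr rfl fun g _ => by ring

lemma ip_sum_right {ι : Type*} (s : Finset ι) (c : ι → ℂ) (f : ι → G → ℂ) (h : G → ℂ) :
    ip h (∑ i ∈ s, c i • f i) = ∑ i ∈ s, c i * ip h (f i) := by
  simp only [ip, Finset.sum_apply, Finset.mul_sum, Pi.smul_apply, smul_eq_mul]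
  rw [Finset.sum_comm]
  refine Finset.sum_congr rfl fun i _ => Finset.sum_congr rfl fun g _ => by ring

lemma norm_one_irr (f : G → ℂ) (hf : f ∈ Submodule.span ℤ (IrrChar G)) (h1 : ip f f = 1)
    (hpos : 0 < (f 1).re) : f ∈ IrrChar G := by
  rw [Finsupp.mem_span_iff_linearCombination] at hf
  obtain ⟨c, rfl⟩ := hf
  have hrep : Finsupp.linearCombination ℤ (fun x : IrrChar G => (x : G → ℂ)) c =
      ∑ i ∈ c.support, ((c i : ℤ) : ℂ) • (i : G → ℂ) := by
    rw [Finsupp.linearCombination_apply, Finsupp.sum]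
    refine Finset.sum_congr rfl fun i _ => ?_
    ext g; simp
  change ip (Finsupp.linearCombination ℤ (fun x : IrrChar G => (x : G → ℂ)) c)
    (Finsupp.linearCombination ℤ (fun x : IrrChar G => (x : G → ℂ)) c) = 1 at h1
  change 0 < ((Finsupp.linearCombination ℤ (fun x : IrrChar G => (x : G → ℂ)) c) 1).re at hpos
  change Finsupp.linearCombination ℤ (fun x : IrrChar G => (x : G → ℂ)) c ∈ _
  rw [hrep] at h1 hpos ⊢
  rw [ip_sum_left] at h1
  have h2 : ∑ i ∈ c.support, (c i) ^ 2 = 1 := by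
    have : ((∑ i ∈ c.support, (c i) ^ 2 : ℤ) : ℂ) = 1 := by
      rw [← h1]
      push_cast
      refine Finset.sum_congr rfl fun i hi => ?_
      rw [ip_sum_right, Finset.sum_eq_single i]
      · rw [ip_irr _ _ i.2 i.2, if_pos rfl]; ring
      · intro j _ hji
        rw [ip_irr _ _ i.2 j.2, if_neg, mul_zero]
        intro h; exact hji (Subtype.ext h.symm)
      · intro h; exact absurd hi h
    exact_mod_cast this
  have hcard : c.support.card = 1 := by
    have hle : (c.support.card : ℤ) ≤ 1 := by
      rw [← h2, Finset.card_eq_sum_ones]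
      push_cast
      apply Finset.sum_le_sum
      intro i hi
      have := Finsupp.mem_support_iff.mp hi
      have : 0 < (c i) ^ 2 := by positivity
      omega
    have : c.support.card ≠ 0 := by
      intro h
      rw [Finset.card_eq_zero] at h
      rw [h] at h2; simp at h2
    omega
  obtain ⟨i, hi⟩ := Finset.card_eq_one.mp hcard
  rw [hi, Finset.sum_singleton] at h2 hpos ⊢
  have hci : c i = 1 ∨ c i = -1 := by
    have : (c i - 1) * (c i + 1) = 0 := by linarith [h2, sq (c i)]
    rcases mul_eq_zero.mp this with h | h
    · left; omega
    · right; omega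
  obtain ⟨V, hV, hVi⟩ := i.2
  rcases hci with h | h
  · rw [h]; simp
  · exfalso
    rw [h, hVi] at hpos
    simp at hpos
    have : (0:ℝ) ≤ (Module.finrank ℂ V : ℝ) := by positivity
    linarith
end reps
end SymDeg

namespace SymDeg
open Finset

section counting
variable {n : ℕ} {α : Type} [Fintype α]

/-- number of occurrences of each letter -/
noncomputable def cnt (W : Fin n → α) (a : α) : ℕ := (univ.filter (fun i => W i = a)).card

lemma sum_cnt (W : Fin n → α) : ∑ a, cnt W a = n := by
  unfold cnt
  rw [← Finset.card_eq_sum_card_fiberwise (f := W) (s := univ) (t := univ) (by simp)]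
  simp

lemma cnt_comp (W : Fin n → α) (g : Equiv.Perm (Fin n)) : cnt (W ∘ g) = cnt W := by
  ext a
  unfold cnt
  refine Finset.card_bij (fun i _ => g i) ?_ ?_ ?_
  · intro i hi; simpa using hi
  · intro i _ j _ h; exact g.injective h
  · intro j hj; exact ⟨g.symm j, by simpa using hj, by simp⟩

lemma exists_word (M : α → ℕ) (hM : ∑ a, M a = n) : ∃ W : Fin n → α, cnt W = M := by
  have hc : Fintype.card (Fin n) = Fintype.card (Σ a, Fin (M a)) := by simp [hM]
  let E := Fintype.equivOfCardEq hc
  refine ⟨fun i => (E i).1, ?_⟩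
  ext a
  unfold cnt
  have : M a = Fintype.card (Fin (M a)) := by simp
  rw [this, ← Fintype.card_subtype]
  refine Fintype.card_congr ?_
  refine (E.subtypeEquiv (q := fun x => x.1 = a) (fun i => Iff.rfl)).trans ?_
  exact Equiv.sigmaSubtype a

lemma exists_perm (W W' : Fin n → α) (h : cnt W = cnt W') : ∃ g : Equiv.Perm (Fin n), W' ∘ g = W := by
  have hE : ∀ a, Nonempty ({i // W i = a} ≃ {i // W' i = a}) := by
    intro a
    rw [← Fintype.card_eq]
    have := congrFun h a
    unfold cnt at this
    rwa [← Fintype.card_subtype, ← Fintype.card_subtype] at this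
  refine ⟨Equiv.ofFiberEquiv (f := W) (g := W') fun a => (hE a).some, ?_⟩
  ext i
  exact Equiv.ofFiberEquiv_map _ i

lemma stab_sum (M : α → ℕ) (hM : ∑ a, M a = n) :
    ∑ W : Fin n → α with cnt W = M, (univ.filter
      (fun g : Equiv.Perm (Fin n) => W ∘ g = W)).card = n.factorial := by
  obtain ⟨W0, hW0⟩ := exists_word M hM
  have h1 : ∀ W ∈ univ.filter (fun W : Fin n → α => cnt W = M),
      (univ.filter (fun g : Equiv.Perm (Fin n) => W ∘ g = W)).card =
      (univ.filter (fun g : Equiv.Perm (Fin n) => W0 ∘ g = W)).card := by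
    intro W hW
    rw [mem_filter] at hW
    obtain ⟨g0, hg0⟩ := exists_perm W W0 (hW.2.trans hW0.symm)
    refine Finset.card_bij (fun g _ => g0 * g) ?_ ?_ ?_
    · intro g hg
      simp only [mem_filter, mem_univ, true_and] at hg ⊢
      rw [Equiv.Perm.coe_mul, ← Function.comp_assoc, hg0, hg]
    · intro a _ b _ h; exact mul_left_cancel h
    · intro g hg
      simp only [mem_filter, mem_univ, true_and] at hg
      refine ⟨g0⁻¹ * g, ?_, by simp⟩
      simp only [mem_filter, mem_univ, true_and]
      conv_lhs => rw [← hg0]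
      rw [Function.comp_assoc, ← Equiv.Perm.coe_mul, mul_inv_cancel_left, hg]
  rw [Finset.sum_congr rfl h1, ← Finset.card_eq_sum_card_fiberwise (s := univ)]
  · simp [Fintype.card_perm]
  · intro g _
    simp [cnt_comp, hW0]

lemma stab_card (W : Fin n → α) : (univ.filter
      (fun g : Equiv.Perm (Fin n) => W ∘ g = W)).card = ∏ a, (cnt W a).factorial := by
  rw [← Fintype.card_subtype, DomMulAct.stabilizer_card]
  refine Finset.prod_congr rfl fun a _ => ?_
  rw [Fintype.card_subtype]; rfl

lemma words_card (M : α → ℕ) (hM : ∑ a, M a = n) :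
    (univ.filter (fun W : Fin n → α => cnt W = M)).card * ∏ a, (M a).factorial = n.factorial := by
  rw [← stab_sum M hM, ← smul_eq_mul, ← Finset.sum_const]
  refine Finset.sum_congr rfl fun W hW => ?_
  rw [stab_card]
  rw [mem_filter] at hW
  rw [hW.2]
end counting
end SymDeg

namespace SymDeg
open Finset

section symm
variable {k : ℕ}

/-- monomials -/
noncomputable def mon (a : Fin k → ℕ) : MvPolynomial (Fin k) ℂ := ∏ i, MvPolynomial.X i ^ a i

lemma mon_eq (a : Fin k → ℕ) :
    mon a = MvPolynomial.monomial (Finsupp.equivFunOnFinite.symm a) 1 := by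
  rw [MvPolynomial.monomial_eq, Finsupp.prod_fintype _ _ (by simp)]
  simp [mon]

lemma mon_add (a b : Fin k → ℕ) : mon (a + b) = mon a * mon b := by
  simp [mon, pow_add, Finset.prod_mul_distrib]

/-- coefficient functional -/
noncomputable def cf (a : Fin k → ℕ) (p : MvPolynomial (Fin k) ℂ) : ℂ :=
  MvPolynomial.coeff (Finsupp.equivFunOnFinite.symm a) p

lemma cf_mon (a b : Fin k → ℕ) : cf a (mon b) = if b = a then 1 else 0 := by
  rw [cf, mon_eq, MvPolynomial.coeff_monomial]
  congr 1
  simp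

lemma cf_mon_mul (a b : Fin k → ℕ) (p : MvPolynomial (Fin k) ℂ) :
    cf a (mon b * p) = if b ≤ a then cf (a - b) p else 0 := by
  rw [cf, mon_eq, MvPolynomial.coeff_monomial_mul']
  have h : (Finsupp.equivFunOnFinite.symm b ≤ Finsupp.equivFunOnFinite.symm a) ↔ b ≤ a := by
    rw [← Finsupp.coe_le_coe]; simp
  simp only [h, one_mul]
  congr 1
  unfold cf
  congr 1
  ext
  simp

lemma cf_sum {ι : Type*} (s : Finset ι) (a : Fin k → ℕ) (p : ι → MvPolynomial (Fin k) ℂ) :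
    cf a (∑ i ∈ s, p i) = ∑ i ∈ s, cf a (p i) := by
  simp [cf, MvPolynomial.coeff_sum]

lemma cf_C_mul (c : ℂ) (a : Fin k → ℕ) (p : MvPolynomial (Fin k) ℂ) :
    cf a (MvPolynomial.C c * p) = c * cf a p := by
  simp [cf]

/-- generating series of complete homogeneous polynomials -/
noncomputable def HH (k : ℕ) : PowerSeries (MvPolynomial (Fin k) ℂ) :=
  ∏ i : Fin k, PowerSeries.mk (fun r => MvPolynomial.X i ^ r)

noncomputable def hp (k r : ℕ) : MvPolynomial (Fin k) ℂ := PowerSeries.coeff r (HH k)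

lemma hp_eq (r : ℕ) : hp k r = ∑ a ∈ piAntidiag univ r, mon a := by
  rw [hp, HH, PowerSeries.coeff_prod]
  refine Finset.sum_nbij' (fun l => ⇑l) (fun a => Finsupp.equivFunOnFinite.symm a) ?_ ?_ ?_ ?_ ?_
  · intro l hl; simpa using hl
  · intro l hl; simpa using hl
  · intro l _; ext; simp
  · intro l _; ext; simp
  · intro l _; simp [mon]

noncomputable def fac (i : Fin k) : PowerSeries (MvPolynomial (Fin k) ℂ) :=
  1 - PowerSeries.C (MvPolynomial.X i) * PowerSeries.X

lemma geom_fac (i : Fin k) :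
    PowerSeries.mk (fun r => (MvPolynomial.X i : MvPolynomial (Fin k) ℂ) ^ r) * fac i = 1 := by
  ext1 m
  rw [fac, mul_sub, mul_one, ← mul_assoc]
  cases m with
  | zero => simp
  | succ m =>
    rw [map_sub, PowerSeries.coeff_succ_mul_X, PowerSeries.coeff_mul_C]
    simp [PowerSeries.coeff_one, pow_succ]

lemma HH_fac (i : Fin k) : HH k * ∏ j ∈ univ.erase i, fac j =
    PowerSeries.mk (fun r => MvPolynomial.X i ^ r) := by
  rw [HH, ← Finset.mul_prod_erase univ _ (mem_univ i), mul_assoc, ← Finset.prod_mul_distrib]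
  rw [Finset.prod_congr rfl fun j _ => geom_fac j]
  simp

/-- matrix entries of the elementary polynomials -/
noncomputable def cc (i : Fin k) (r : ℕ) : MvPolynomial (Fin k) ℂ :=
  PowerSeries.coeff r (∏ j ∈ univ.erase i, fac j)

lemma coeff_prod_fac (s : Finset (Fin k)) : ∀ r, s.card < r →
    PowerSeries.coeff r (∏ j ∈ s, fac j) = 0 := by
  induction s using Finset.induction_on with
  | empty => intro r hr; simp [PowerSeries.coeff_one]; simp at hr; omega
  | insert a s ha ih =>
    intro r hr
    rw [card_insert_of_notMem ha] at hr
    rw [prod_insert ha, fac, sub_mul, one_mul, map_sub, ih r (by omega)]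
    obtain ⟨r, rfl⟩ : ∃ r', r = r' + 1 := ⟨r - 1, by omega⟩
    rw [mul_comm (PowerSeries.C _), mul_assoc, PowerSeries.coeff_succ_X_mul,
      PowerSeries.coeff_C_mul, ih r (by omega)]
    simp

lemma cc_zero (i : Fin k) (r : ℕ) (hr : k ≤ r) : cc i r = 0 := by
  apply coeff_prod_fac
  rw [card_erase_of_mem (mem_univ i)]
  have := i.2
  simp; omega

noncomputable def hc (k p r : ℕ) : MvPolynomial (Fin k) ℂ := if r ≤ p then hp k (p - r) else 0

lemma pow_eq (i : Fin k) (p : ℕ) : (MvPolynomial.X i : MvPolynomial (Fin k) ℂ) ^ p =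
    ∑ r : Fin k, hc k p r * cc i r := by
  have h := congrArg (PowerSeries.coeff p) (HH_fac i)
  rw [PowerSeries.coeff_mk] at h
  rw [← h, mul_comm, PowerSeries.coeff_mul, Finset.Nat.sum_antidiagonal_eq_sum_range_succ_mk]
  rw [Fin.sum_univ_eq_sum_range (fun r => hc k p r * cc i r) k]
  have h1 : ∑ r ∈ range k, hc k p r * cc i r = ∑ r ∈ range (max k (p+1)), hc k p r * cc i r := by
    apply Finset.sum_subset (range_subset_range.mpr (le_max_left _ _))
    intro r _ hr
    rw [mem_range, not_lt] at hr
    rw [cc_zero i r hr, mul_zero]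
  rw [h1]
  have h2 : ∑ r ∈ range (p+1), hc k p r * cc i r = ∑ r ∈ range (max k (p+1)), hc k p r * cc i r := by
    apply Finset.sum_subset (range_subset_range.mpr (le_max_right _ _))
    intro r _ hr
    rw [mem_range, not_lt] at hr
    rw [hc, if_neg (by omega), zero_mul]
  rw [← h2]
  refine Finset.sum_congr rfl fun r hr => ?_
  rw [mem_range] at hr
  rw [hc, if_pos (by omega), mul_comm]; rfl

/-- alternants -/
noncomputable def alt (m : Fin k → ℕ) : MvPolynomial (Fin k) ℂ :=
  (Matrix.of fun r j : Fin k => (MvPolynomial.X j : MvPolynomial (Fin k) ℂ) ^ m r).det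

noncomputable def jt (m : Fin k → ℕ) : MvPolynomial (Fin k) ℂ :=
  (Matrix.of fun r j : Fin k => hc k (m r) j).det

lemma alt_eq_aux (m : Fin k → ℕ) : alt m = jt m *
    (Matrix.of fun r j : Fin k => cc j (r : ℕ)).det := by
  rw [alt, jt, ← Matrix.det_mul]
  congr 1
  ext1 r j
  rw [Matrix.mul_apply]
  simp [pow_eq]

lemma jt_zero : jt (fun i : Fin k => (i : ℕ)) = 1 := by
  rw [jt, Matrix.det_of_isLowerTriangular]
  · apply Finset.prod_eq_one
    intro i _
    simp only [Matrix.of_apply, hc, le_refl, if_true, Nat.sub_self, hp, HH]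
    rw [PowerSeries.coeff_zero_eq_constantCoeff, map_prod]
    apply Finset.prod_eq_one
    intro j _
    rw [← PowerSeries.coeff_zero_eq_constantCoeff, PowerSeries.coeff_mk, pow_zero]
  · intro i j hij
    simp only [OrderDual.toDual_lt_toDual] at hij
    simp only [Matrix.of_apply, hc]
    rw [if_neg]
    rw [Fin.lt_def] at hij; omega

/-- Vandermonde -/
noncomputable def vdm (k : ℕ) : MvPolynomial (Fin k) ℂ := alt (fun i : Fin k => (i : ℕ))

lemma bialternant (m : Fin k → ℕ) : vdm k * jt m = alt m := by
  rw [vdm, alt_eq_aux (fun i : Fin k => (i : ℕ)), jt_zero, alt_eq_aux m]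
  ring

lemma alt_expand (m : Fin k → ℕ) : alt m =
    ∑ σ : Equiv.Perm (Fin k), MvPolynomial.C ((Equiv.Perm.sign σ : ℤ) : ℂ) * mon (m ∘ σ) := by
  rw [alt, Matrix.det_apply']
  refine Finset.sum_congr rfl fun σ _ => ?_
  simp [mon]

lemma jt_expand (m : Fin k → ℕ) : jt m =
    ∑ σ : Equiv.Perm (Fin k), MvPolynomial.C ((Equiv.Perm.sign σ : ℤ) : ℂ) *
      if (fun j => ((σ j : Fin k) : ℕ)) ≤ m then ∏ j, hp k (m j - σ j) else 0 := by
  rw [jt, ← Matrix.det_transpose, Matrix.det_apply']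
  refine Finset.sum_congr rfl fun σ _ => ?_
  congr 1
  · simp only [Matrix.transpose_apply, Matrix.of_apply, hc]
    split_ifs with h
    · exact Finset.prod_congr rfl fun j _ => if_pos (h j)
    · rw [Pi.le_def] at h
      push Not at h
      obtain ⟨j, hj⟩ := h
      exact Finset.prod_eq_zero (mem_univ j) (if_neg (by omega))

lemma perm_of_strictMono {l m : Fin k → ℕ} (hl : StrictMono l) (hm : StrictMono m)
    (σ : Equiv.Perm (Fin k)) (h : m ∘ σ = l) : σ = 1 := by
  have hs : StrictMono σ := by
    intro i j hij
    have := hl hij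
    rw [← h] at this
    exact hm.lt_iff_lt.mp this
  have h2 := Subsingleton.elim (hs.orderIsoOfSurjective σ σ.surjective) (OrderIso.refl _)
  ext i
  have := congrArg (fun f : Fin k ≃o Fin k => (f i : Fin k)) h2
  simpa using congrArg Fin.val this

lemma cf_alt (l m : Fin k → ℕ) (hl : StrictMono l) (hm : StrictMono m) :
    cf l (alt m) = if l = m then 1 else 0 := by
  rw [alt_expand, cf_sum, Finset.sum_eq_single 1]
  · rw [cf_C_mul, cf_mon]
    simp [eq_comm]
  · intro σ _ hσ
    rw [cf_C_mul, cf_mon, if_neg, mul_zero]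
    intro h
    exact hσ (perm_of_strictMono hl hm σ h)
  · simp

end symm
end SymDeg

namespace SymDeg
open Finset

section chars
variable {k n : ℕ}

/-- permutation characters on words -/
noncomputable def perc (b : Fin k → ℕ) (g : Equiv.Perm (Fin n)) : ℂ :=
  ((univ.filter (fun w : Fin n → Fin k => w ∘ g = w ∧ cnt w = b)).card : ℂ)

noncomputable def PP (k : ℕ) (g : Equiv.Perm (Fin n)) : MvPolynomial (Fin k) ℂ :=
  ∑ w : Fin n → Fin k with w ∘ g = w, mon (cnt w)

lemma cf_PP (b : Fin k → ℕ) (g : Equiv.Perm (Fin n)) : cf b (PP k g) = perc b g := by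
  rw [PP, cf_sum, perc]
  simp_rw [cf_mon]
  rw [← Finset.sum_filter, Finset.filter_filter]
  simp

lemma perc_zero (b : Fin k → ℕ) (g : Equiv.Perm (Fin n)) (h : ∑ i, b i ≠ n) : perc b g = 0 := by
  rw [perc, Finset.card_eq_zero.mpr]
  · simp
  · apply Finset.filter_eq_empty_iff.mpr
    rintro w _ ⟨_, rfl⟩
    exact h (sum_cnt w)

lemma fix_inv (w : Fin n → Fin k) (g : Equiv.Perm (Fin n)) : w ∘ (g⁻¹ : Equiv.Perm (Fin n)) = w ↔ w ∘ g = w := by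
  constructor
  · intro h
    conv_lhs => rw [← h]
    rw [Function.comp_assoc, ← Equiv.Perm.coe_mul]; simp
  · intro h
    conv_lhs => rw [← h]
    rw [Function.comp_assoc, ← Equiv.Perm.coe_mul]; simp

lemma PP_inv (g : Equiv.Perm (Fin n)) : PP k g⁻¹ = PP k g := by
  unfold PP
  simp_rw [fix_inv]

lemma cnt_snd (W : Fin n → Fin k × Fin k) (j : Fin k) :
    cnt (Prod.snd ∘ W) j = ∑ i, cnt W (i, j) := by
  unfold cnt
  rw [Finset.card_eq_sum_card_fiberwise (f := fun x => (W x).1) (t := univ) (by simp)]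
  refine Finset.sum_congr rfl fun i _ => ?_
  rw [Finset.filter_filter]
  congr 1
  ext x
  simp [Prod.ext_iff, and_comm]

lemma cnt_fst (W : Fin n → Fin k × Fin k) (i : Fin k) :
    cnt (Prod.fst ∘ W) i = ∑ j, cnt W (i, j) := by
  unfold cnt
  rw [Finset.card_eq_sum_card_fiberwise (f := fun x => (W x).2) (t := univ) (by simp)]
  refine Finset.sum_congr rfl fun j _ => ?_
  rw [Finset.filter_filter]
  congr 1
  ext x
  simp [Prod.ext_iff]

lemma mon_sum (M : Fin k → Fin k → ℕ) : mon (fun i => ∑ j, M j i) = ∏ j, mon (M j) := by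
  unfold mon
  rw [Finset.prod_comm]
  refine Finset.prod_congr rfl fun i _ => ?_
  rw [Finset.prod_pow_eq_pow_sum]

lemma pair_lhs (b : Fin k → ℕ) :
    ∑ g : Equiv.Perm (Fin n), MvPolynomial.C (perc b g) * PP k g =
    ∑ W : Fin n → Fin k × Fin k with cnt (Prod.snd ∘ W) = b,
      ((univ.filter (fun g : Equiv.Perm (Fin n) => W ∘ g = W)).card : MvPolynomial (Fin k) ℂ) *
        mon (cnt (Prod.fst ∘ W)) := by
  have h1 : ∀ W : Fin n → Fin k × Fin k,
      ((univ.filter (fun g : Equiv.Perm (Fin n) => W ∘ g = W)).card : MvPolynomial (Fin k) ℂ) *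
        mon (cnt (Prod.fst ∘ W)) = ∑ g : Equiv.Perm (Fin n),
        if W ∘ g = W then mon (cnt (Prod.fst ∘ W)) else 0 := by
    intro W
    rw [← Finset.sum_filter, Finset.sum_const, nsmul_eq_mul]
  rw [Finset.sum_congr rfl fun W _ => h1 W, Finset.sum_comm]
  refine Finset.sum_congr rfl fun g _ => ?_
  rw [Finset.sum_filter, ← Equiv.sum_comp (Equiv.arrowProdEquivProdArrow (Fin n) _ _).symm,
    Fintype.sum_prod_type_right]
  rw [perc, PP, map_natCast, ← nsmul_eq_mul, ← Finset.sum_const, Finset.sum_filter]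
  refine Finset.sum_congr rfl fun w _ => ?_
  rw [Finset.sum_filter]
  have h2 : ∀ v : Fin n → Fin k,
    (((Equiv.arrowProdEquivProdArrow (Fin n) (fun _ => Fin k) (fun _ => Fin k)).symm (v, w)) ∘ g =
      ((Equiv.arrowProdEquivProdArrow (Fin n) (fun _ => Fin k) (fun _ => Fin k)).symm (v, w))) ↔
      (v ∘ g = v ∧ w ∘ g = w) := by
    intro v
    simp only [funext_iff, Function.comp_apply, Equiv.arrowProdEquivProdArrow, Equiv.coe_fn_symm_mk,
      Prod.ext_iff]
    exact forall_and
  simp_rw [h2]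
  have h3 : ∀ v : Fin n → Fin k, Prod.fst ∘ ((Equiv.arrowProdEquivProdArrow (Fin n)
    (fun _ => Fin k) (fun _ => Fin k)).symm (v, w)) = v := fun v => rfl
  have h4 : ∀ v : Fin n → Fin k, Prod.snd ∘ ((Equiv.arrowProdEquivProdArrow (Fin n)
    (fun _ => Fin k) (fun _ => Fin k)).symm (v, w)) = w := fun v => rfl
  simp_rw [h3, h4]
  by_cases hb : cnt w = b <;> by_cases hw : w ∘ g = w <;> simp [hb, hw]

lemma pair_eq (b : Fin k → ℕ) (hb : ∑ i, b i = n) :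
    ∑ g : Equiv.Perm (Fin n), MvPolynomial.C (perc b g) * PP k g =
    MvPolynomial.C (n.factorial : ℂ) * ∏ j, hp k (b j) := by
  rw [pair_lhs]
  simp_rw [hp_eq]
  rw [Finset.prod_univ_sum, Finset.mul_sum]
  rw [← Finset.sum_fiberwise_of_maps_to (g := fun W j i => cnt W (i, j))
    (t := Fintype.piFinset fun j => piAntidiag univ (b j))]
  · refine Finset.sum_congr rfl fun M hM => ?_
    rw [← mon_sum M]
    simp only [Fintype.mem_piFinset, mem_piAntidiag] at hM
    have hMn : ∑ x : Fin k × Fin k, (fun x : Fin k × Fin k => M x.2 x.1) x = n := by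
      rw [Fintype.sum_prod_type_right, ← hb]
      exact Finset.sum_congr rfl fun j _ => (hM j).1
    rw [map_natCast, ← stab_sum _ hMn, Nat.cast_sum, Finset.sum_mul, Finset.filter_filter]
    refine Finset.sum_congr ?_ ?_
    · ext W
      simp only [mem_filter, mem_univ, true_and]
      constructor
      · rintro ⟨_, h⟩
        ext ⟨i, j⟩
        exact congrFun (congrFun h j) i
      · intro h
        refine ⟨?_, ?_⟩
        · ext j
          rw [cnt_snd, h]; exact (hM j).1
        · ext j i; rw [h]
    · intro W hW
      simp only [mem_filter, mem_univ, true_and] at hW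
      refine congrArg₂ _ (by congr!) (congrArg mon ?_)
      ext i
      rw [cnt_fst, hW]
  · intro W hW
    simp only [mem_filter, mem_univ, true_and] at hW
    simp only [Fintype.mem_piFinset, mem_piAntidiag]
    intro j
    refine ⟨?_, by simp⟩
    rw [← cnt_snd, hW]

/-- the (virtual) characters -/
noncomputable def chi (l : Fin k → ℕ) (g : Equiv.Perm (Fin n)) : ℂ := cf l (vdm k * PP k g)

lemma chi_expand (l : Fin k → ℕ) (g : Equiv.Perm (Fin n)) : chi l g =
    ∑ σ : Equiv.Perm (Fin k), ((Equiv.Perm.sign σ : ℤ) : ℂ) *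
      if (fun j => ((σ j : Fin k) : ℕ)) ≤ l then perc (l - fun j => ((σ j : Fin k) : ℕ)) g else 0 := by
  rw [chi, vdm, alt_expand, Finset.sum_mul, cf_sum]
  refine Finset.sum_congr rfl fun σ _ => ?_
  rw [mul_assoc, cf_C_mul, cf_mon_mul, cf_PP]
  rfl

lemma sum_tsub (l : Fin k → ℕ) (σ : Equiv.Perm (Fin k)) (h : (fun j => ((σ j : Fin k) : ℕ)) ≤ l)
    (hl : ∑ i, l i = n + ∑ i : Fin k, (i : ℕ)) :
    ∑ i, (l - fun j => ((σ j : Fin k) : ℕ)) i = n := by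
  have h1 : ∑ i, (l - fun j => ((σ j : Fin k) : ℕ)) i + ∑ i : Fin k, (i : ℕ) = n + ∑ i : Fin k, (i : ℕ) := by
    rw [← hl, ← Equiv.sum_comp σ (fun i : Fin k => (i : ℕ)), ← Finset.sum_add_distrib]
    refine Finset.sum_congr rfl fun i _ => ?_
    exact Nat.sub_add_cancel (h i)
  omega

lemma sum_chi_PP (l : Fin k → ℕ) (hl : ∑ i, l i = n + ∑ i : Fin k, (i : ℕ)) :
    ∑ g : Equiv.Perm (Fin n), MvPolynomial.C (chi l g) * PP k g =
    MvPolynomial.C (n.factorial : ℂ) * jt l := by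
  simp_rw [chi_expand, map_sum, Finset.sum_mul]
  rw [Finset.sum_comm, jt_expand, Finset.mul_sum]
  refine Finset.sum_congr rfl fun σ _ => ?_
  split_ifs with h
  · rw [mul_left_comm]
    have := pair_eq (l - fun j => ((σ j : Fin k) : ℕ)) (sum_tsub l σ h hl)
    simp only [Pi.sub_apply] at this
    rw [← this, Finset.mul_sum]
    refine Finset.sum_congr rfl fun g _ => ?_
    rw [map_mul, mul_assoc]
  · simp

lemma chi_orth (l m : Fin k → ℕ) (hl : ∑ i, l i = n + ∑ i : Fin k, (i : ℕ))
    (hls : StrictMono l) (hms : StrictMono m) :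
    ∑ g : Equiv.Perm (Fin n), chi l g * chi m g = if m = l then (n.factorial : ℂ) else 0 := by
  have h : cf m (vdm k * ∑ g : Equiv.Perm (Fin n), MvPolynomial.C (chi l g) * PP k g) =
    cf m (vdm k * (MvPolynomial.C (n.factorial : ℂ) * jt l)) := by rw [sum_chi_PP l hl]
  rw [mul_left_comm, bialternant, cf_C_mul, cf_alt m l hms hls, Finset.mul_sum, cf_sum] at h
  rw [mul_ite, mul_one, mul_zero] at h
  rw [← h]
  refine Finset.sum_congr rfl fun g _ => ?_
  rw [mul_left_comm, cf_C_mul]; rfl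

lemma chi_inv (l : Fin k → ℕ) (g : Equiv.Perm (Fin n)) : chi l g⁻¹ = chi l g := by
  rw [chi, PP_inv]; rfl

lemma chi_int (l : Fin k → ℕ) (g : Equiv.Perm (Fin n)) : ∃ z : ℤ, chi l g = z := by
  rw [chi_expand]
  refine ⟨∑ σ : Equiv.Perm (Fin k), (Equiv.Perm.sign σ : ℤ) *
      if (fun j => ((σ j : Fin k) : ℕ)) ≤ l then
      ((univ.filter (fun w : Fin n → Fin k => w ∘ g = w ∧
        cnt w = (l - fun j => ((σ j : Fin k) : ℕ)))).card : ℤ) else 0, ?_⟩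
  push_cast
  rfl

lemma perc_one (a : Fin k → ℕ) (ha : ∑ i, a i = n) :
    perc a (1 : Equiv.Perm (Fin n)) = (n.factorial : ℂ) * ∏ i, (1 / ((a i).factorial : ℂ)) := by
  have h := words_card a ha
  have h2 : (((univ.filter (fun W : Fin n → Fin k => cnt W = a)).card * ∏ i, (a i).factorial : ℕ) : ℂ)
    = n.factorial := by rw [h]
  push_cast at h2
  rw [← h2, perc]
  have h3 : ∀ i, ((a i).factorial : ℂ) ≠ 0 := fun i => by exact_mod_cast (Nat.factorial_ne_zero _)
  rw [mul_assoc, ← Finset.prod_mul_distrib, Finset.prod_eq_one, mul_one]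
  · simp
  · intro i _; field_simp [h3 i]

lemma chi_one (l : Fin k → ℕ) (hl : ∑ i, l i = n + ∑ i : Fin k, (i : ℕ)) :
    chi l (1 : Equiv.Perm (Fin n)) = ((n.factorial * FF (fun i => (l i : ℤ)) : ℝ) : ℂ) := by
  rw [chi_expand, FF, ← Matrix.det_transpose, Matrix.det_apply', Finset.mul_sum]
  push_cast
  refine Finset.sum_congr rfl fun σ _ => ?_
  rw [mul_left_comm]
  congr 1
  split_ifs with h
  · rw [perc_one _ (sum_tsub l σ h hl)]
    congr 1
    refine Finset.prod_congr rfl fun i _ => ?_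
    simp only [Matrix.transpose_apply, MM, Matrix.of_apply]
    rw [← Nat.cast_sub (h i), gInv_nat]
    simp
  · rw [Pi.le_def] at h
    push Not at h
    obtain ⟨j, hj⟩ := h
    rw [Finset.prod_eq_zero (mem_univ j), mul_zero]
    simp only [Matrix.transpose_apply, MM, Matrix.of_apply]
    rw [gInv_neg]
    · simp
    · omega

end chars
end SymDeg

namespace SymDeg
open Finset

section fin
variable {k n : ℕ}

/-- permutation representation on words of given content -/
noncomputable def prep (b : Fin k → ℕ) :
    Representation ℂ (Equiv.Perm (Fin n)) ({w : Fin n → Fin k // cnt w = b} → ℂ) where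
  toFun g := LinearMap.funLeft ℂ ℂ (fun w => ⟨w.1 ∘ g, by rw [cnt_comp, w.2]⟩)
  map_one' := by
    ext f w; rfl
  map_mul' g h := by
    ext f w; rfl

lemma prep_char (b : Fin k → ℕ) :
    (prep b : Representation ℂ (Equiv.Perm (Fin n)) _).character = perc b := by
  ext g
  rw [Representation.character, LinearMap.trace_eq_matrix_trace ℂ (Pi.basisFun ℂ _), Matrix.trace]
  have h : ∀ w : {w : Fin n → Fin k // cnt w = b},
      (LinearMap.toMatrix (Pi.basisFun ℂ _) (Pi.basisFun ℂ _) (prep b g)).diag w =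
      if w.1 ∘ g = w.1 then 1 else 0 := by
    intro w
    rw [Matrix.diag_apply, LinearMap.toMatrix_apply]
    simp [prep, LinearMap.funLeft_apply, Pi.single_apply, Subtype.ext_iff]
  rw [Finset.sum_congr rfl fun w _ => h w, perc]
  rw [Finset.sum_boole]
  congr 1
  rw [← Fintype.card_subtype, ← Fintype.card_subtype]
  exact Fintype.card_congr ((Equiv.subtypeSubtypeEquivSubtypeInter (fun w : Fin n → Fin k => cnt w = b)
    (fun w => w ∘ g = w)).trans
    (Equiv.subtypeEquivRight fun w => and_comm))

lemma chi_mem (l : Fin k → ℕ) :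
    (chi l : Equiv.Perm (Fin n) → ℂ) ∈ Submodule.span ℤ (IrrChar (Equiv.Perm (Fin n))) := by
  have h : (chi l : Equiv.Perm (Fin n) → ℂ) = ∑ σ : Equiv.Perm (Fin k), (Equiv.Perm.sign σ : ℤ) •
      if (fun j => ((σ j : Fin k) : ℕ)) ≤ l then perc (l - fun j => ((σ j : Fin k) : ℕ)) else 0 := by
    ext g
    rw [chi_expand, Finset.sum_apply]
    refine Finset.sum_congr rfl fun σ _ => ?_
    split_ifs <;> simp
  rw [h]
  refine Submodule.sum_mem _ fun σ _ => Submodule.smul_mem _ _ ?_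
  split_ifs
  · rw [← prep_char]
    exact char_mem_span _ _ _ rfl
  · exact zero_mem _

lemma chi_irr (l : Fin k → ℕ) (hl : ∑ i, l i = n + ∑ i : Fin k, (i : ℕ)) (hls : StrictMono l) :
    (chi l : Equiv.Perm (Fin n) → ℂ) ∈ IrrChar (Equiv.Perm (Fin n)) := by
  apply norm_one_irr _ (chi_mem l)
  · rw [ip]
    simp_rw [chi_inv]
    rw [chi_orth l l hl hls hls, if_pos rfl, Nat.card_eq_fintype_card, Fintype.card_perm,
      Fintype.card_fin]
    exact inv_mul_cancel₀ (by exact_mod_cast Nat.factorial_ne_zero n)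
  · rw [chi_one l hl, Complex.ofReal_re]
    have := FF_pos (fun i => (l i : ℤ)) (fun i => by positivity)
      (fun i j h => by have := hls h; simpa using this)
    positivity

lemma perc_perm (b : Fin k → ℕ) (τ : Equiv.Perm (Fin k)) (g : Equiv.Perm (Fin n)) :
    perc (b ∘ τ) g = perc b g := by
  unfold perc
  congr 1
  refine Finset.card_bij (fun w _ => τ ∘ w) ?_ ?_ ?_
  · intro w hw
    simp only [mem_filter, mem_univ, true_and] at hw ⊢
    refine ⟨by rw [Function.comp_assoc, hw.1], ?_⟩
    ext a
    have := congrFun hw.2 (τ.symm a)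
    simp only [Function.comp_apply, Equiv.apply_symm_apply] at this
    rw [← this]
    unfold cnt
    congr 1
    ext i
    simp [Equiv.eq_symm_apply]
  · intro w _ w' _ h
    exact τ.injective.comp_left h
  · intro w hw
    simp only [mem_filter, mem_univ, true_and] at hw
    refine ⟨τ.symm ∘ w, ?_, ?_⟩
    · simp only [mem_filter, mem_univ, true_and]
      refine ⟨by rw [Function.comp_assoc, hw.1], ?_⟩
      ext a
      rw [← hw.2]
      unfold cnt
      simp only [Function.comp_apply]
      congr 1
      ext i
      simp [Equiv.symm_apply_eq]
    · ext i; simp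

lemma chi_perm (l : Fin k → ℕ) (τ : Equiv.Perm (Fin k)) (g : Equiv.Perm (Fin n)) :
    chi (l ∘ τ) g = ((Equiv.Perm.sign τ : ℤ) : ℂ) * chi l g := by
  rw [chi_expand, chi_expand, Finset.mul_sum, ← Equiv.sum_comp (Equiv.mulRight τ)]
  refine Finset.sum_congr rfl fun σ _ => ?_
  have h1 : ((fun j => (((Equiv.mulRight τ σ) j : Fin k) : ℕ)) ≤ l ∘ τ) ↔
      (fun j => ((σ j : Fin k) : ℕ)) ≤ l := by
    constructor
    · intro h j
      have := h (τ.symm j)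
      simpa using this
    · intro h j
      exact h (τ j)
  simp only [h1]
  rw [← mul_assoc]
  congr 1
  · simp [mul_comm]
  · split_ifs
    · rw [← perc_perm (l - fun j => ((σ j : Fin k) : ℕ)) τ]
      rfl
    · rfl

lemma chi_sum_ne (l : Fin k → ℕ) (g : Equiv.Perm (Fin n))
    (hl : ∑ i, l i ≠ n + ∑ i : Fin k, (i : ℕ)) : chi l g = 0 := by
  rw [chi_expand]
  apply Finset.sum_eq_zero
  intro σ _
  split_ifs with h
  · rw [perc_zero, mul_zero]
    intro h2
    apply hl
    rw [← h2, ← Equiv.sum_comp σ (fun i : Fin k => (i : ℕ)), ← Finset.sum_add_distrib]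
    refine Finset.sum_congr rfl fun i _ => ?_
    exact (Nat.sub_add_cancel (h i)).symm
  · simp

lemma vdm_ne : vdm k ≠ 0 := by
  intro h
  have h1 := cf_alt (fun i : Fin k => (i : ℕ)) (fun i : Fin k => (i : ℕ))
    (fun i j h => h) (fun i j h => h)
  rw [if_pos rfl] at h1
  change cf _ (vdm k) = 1 at h1
  rw [h] at h1
  simp [cf] at h1

lemma exists_chi (φ : Equiv.Perm (Fin n) → ℂ) (hφ : φ 1 ≠ 0) :
    ∃ l : Fin (n + 1) → ℕ, StrictMono l ∧ ip (chi l) φ ≠ 0 := by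
  by_contra hcon
  push Not at hcon
  have hcard : ((Nat.card (Equiv.Perm (Fin n)) : ℂ))⁻¹ ≠ 0 :=
    inv_ne_zero (NeZero.ne _)
  have h0 : ∀ l : Fin (n + 1) → ℕ, StrictMono l →
      ∑ g : Equiv.Perm (Fin n), chi l g * φ g⁻¹ = 0 := by
    intro l hl
    have := hcon l hl
    rw [ip] at this
    exact (mul_eq_zero.mp this).resolve_left hcard
  have h1 : ∀ l : Fin (n + 1) → ℕ, ∑ g : Equiv.Perm (Fin n), chi l g * φ g⁻¹ = 0 := by
    intro l
    by_cases hinj : Function.Injective l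
    · have hs : StrictMono (l ∘ Tuple.sort l) :=
        (Tuple.monotone_sort l).strictMono_of_injective (hinj.comp (Tuple.sort l).injective)
      have := h0 _ hs
      simp_rw [chi_perm, mul_assoc] at this
      rw [← Finset.mul_sum] at this
      refine (mul_eq_zero.mp this).resolve_left ?_
      simp
    · unfold Function.Injective at hinj
      push Not at hinj
      obtain ⟨i, j, hij, hne⟩ := hinj
      have hl : l ∘ Equiv.swap i j = l := by
        ext x
        simp only [Function.comp_apply, Equiv.swap_apply_def]
        split_ifs with h1 h2
        · rw [h1, hij]
        · rw [h2, hij]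
        · rfl
      apply Finset.sum_eq_zero
      intro g _
      have := chi_perm l (Equiv.swap i j) g
      rw [hl, Equiv.Perm.sign_swap hne] at this
      have h3 : chi l g = 0 := by
        have : chi l g = - chi l g := by simpa using this
        have h4 : 2 * chi l g = 0 := by linear_combination this
        simpa using h4
      rw [h3, zero_mul]
  have h2 : vdm (n + 1) * ∑ g : Equiv.Perm (Fin n), MvPolynomial.C (φ g⁻¹) * PP (n + 1) g = 0 := by
    apply MvPolynomial.ext
    intro m
    rw [MvPolynomial.coeff_zero]
    have hm : m = Finsupp.equivFunOnFinite.symm ⇑m := by ext; simp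
    rw [hm]
    change cf (⇑m) _ = 0
    rw [Finset.mul_sum, cf_sum, ← h1 m]
    refine Finset.sum_congr rfl fun g _ => ?_
    rw [mul_left_comm, cf_C_mul, mul_comm]; rfl
  have h3 := (mul_eq_zero.mp h2).resolve_left vdm_ne
  have h4 : ∀ b : Fin (n + 1) → ℕ, ∑ g : Equiv.Perm (Fin n), φ g⁻¹ * perc b g = 0 := by
    intro b
    have := congrArg (cf b) h3
    rw [cf_sum] at this
    simp_rw [cf_C_mul, cf_PP] at this
    rw [this]; simp [cf]
  let b : Fin (n + 1) → ℕ := fun j => if j = 0 then 0 else 1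
  have hb : ∑ j, b j = n := by
    simp [b, Fin.sum_univ_succ]
  have h5 := h4 b
  rw [Finset.sum_eq_single 1] at h5
  · rw [perc_one b hb, inv_one] at h5
    have hf : (n.factorial : ℂ) ≠ 0 := by exact_mod_cast Nat.factorial_ne_zero n
    have hpr : ∏ i, (1 / ((b i).factorial : ℂ)) = 1 := by
      apply Finset.prod_eq_one
      intro i _
      simp only [b]
      split_ifs <;> simp
    rw [hpr, mul_one] at h5
    exact (mul_ne_zero hφ hf) h5
  · intro g _ hg
    rw [perc, Finset.card_eq_zero.mpr]
    · simp
    · apply Finset.filter_eq_empty_iff.mpr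
      rintro w _ ⟨hw, hcw⟩
      apply hg
      have hinj : Function.Injective w := by
        intro x y hxy
        have h6 : cnt w (w x) ≤ 1 := by
          rw [hcw]; simp only [b]; split_ifs <;> simp
        unfold cnt at h6
        rw [Finset.card_le_one] at h6
        exact h6 x (by simp) y (by simp [hxy])
      ext x
      have := hinj (congrFun hw x)
      simp [this]
  · simp

lemma sum_cast (l : Fin k → ℕ) : (∑ i, (l i : ℤ) = n + S0 k) ↔
    ∑ i, l i = n + ∑ i : Fin k, (i : ℕ) := by
  unfold S0
  constructor
  · intro h; exact_mod_cast h
  · intro h; exact_mod_cast h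

lemma irr_deg (φ : Equiv.Perm (Fin n) → ℂ) (hφ : φ ∈ IrrChar (Equiv.Perm (Fin n))) :
    ∃ l : Fin (n + 1) → ℤ, Sh n l ∧ (φ 1).re = n.factorial * FF l := by
  have hne : φ 1 ≠ 0 := by
    intro h0
    have h1 := ip_irr φ φ hφ hφ
    obtain ⟨V, hV, rfl⟩ := hφ
    rw [FDRep.char_one] at h0
    have h0' : Module.finrank ℂ V = 0 := by exact_mod_cast h0
    have : Subsingleton V := Module.finrank_zero_iff.mp h0'
    have h2 : FDRep.character V = 0 := by
      ext g
      have : V.ρ g = 0 := by ext v; exact Subsingleton.elim _ _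
      rw [FDRep.character, this]; simp
    rw [h2] at h1
    simp [ip] at h1
  obtain ⟨l, hls, hl⟩ := exists_chi φ hne
  have hsum : ∑ i, l i = n + ∑ i : Fin (n + 1), (i : ℕ) := by
    by_contra h
    apply hl
    simp [ip, chi_sum_ne l _ h]
  have hirr := chi_irr l hsum hls
  rw [ip_irr _ _ hirr hφ] at hl
  have heq : chi l = φ := by
    by_contra h; rw [if_neg h] at hl; exact hl rfl
  refine ⟨fun i => (l i : ℤ), ⟨fun i j h => by have := hls h; simpa using this,
    fun i => by positivity, (sum_cast l).mpr hsum⟩, ?_⟩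
  rw [← heq, chi_one l hsum, Complex.ofReal_re]

lemma deg_irr (l : Fin (n + 1) → ℤ) (hl : Sh n l) :
    ∃ ψ ∈ IrrChar (Equiv.Perm (Fin n)), (ψ 1).re = n.factorial * FF l := by
  obtain ⟨l', rfl⟩ : ∃ l' : Fin (n + 1) → ℕ, l = fun i => (l' i : ℤ) :=
    ⟨fun i => (l i).toNat, by ext i; simp [hl.2.1 i]⟩
  have hsum := (sum_cast l').mp hl.2.2
  refine ⟨chi l', chi_irr l' hsum (fun i j h => by have := hl.1 h; simpa using this), ?_⟩
  rw [chi_one l' hsum, Complex.ofReal_re]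

end fin
end SymDeg

theorem stmt1 (S : Set ℝ) (hS : S.Finite) :
    ∃ (N : ℕ) (δ : ℝ), 0 < δ ∧
      ∀ n : ℕ, N < n →
        ∀ φ ∈ IrrChar (Equiv.Perm (Fin n)),
          ∃ ψ ∈ IrrChar (Equiv.Perm (Fin n)),
            (ψ 1).re / (φ 1).re ∈ Set.Ici δ \ S := by
  obtain ⟨N, δ, hδ, h⟩ := SymDeg.analytic S hS
  refine ⟨N, δ, hδ, fun n hn φ hφ => ?_⟩
  obtain ⟨l, hl, h1⟩ := SymDeg.irr_deg φ hφ
  obtain ⟨l', hl', h2⟩ := h n hn l hl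
  obtain ⟨ψ, hψ, h3⟩ := SymDeg.deg_irr l' hl'
  refine ⟨ψ, hψ, ?_⟩
  rw [h1, h3, mul_div_mul_left]
  · exact h2
  · exact_mod_cast n.factorial_ne_zero
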